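/- Suppose there are infinitely many triples of integers (u, v, w) with 1 ≤ u < v < w such that 1 + uv = T_x, 1 + uw = T_y and 1 + vw = T_z hold for some positive integers x, y, z. Then there exist rational numbers r₁, r₂, r₃, s₁, s₂, s₃ such that infinitely many of the corresponding solution triples (x, y, z) are of the form (r₁·n + s₁, r₂·n + s₂, r₃·n + s₃) for some integer n; i.e., infinitely many of the exponent triples (x,y,z) lie on a single rational line in ℝ³ parametrized at integer values. -/

import Mathlib

/-- The Tribonacci sequence. -/
def T : ℕ → ℕ
  | 0 => 0
  | 1 => 0
  | 2 => 1
  | (n + 3) => T (n + 2) + T (n + 1) + T n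

open Polynomial in
theorem exists_al : ∃ a : ℝ, a ^ 3 = a ^ 2 + a + 1 ∧ 1.83 < a ∧ a < 1.84 := by
  have hc : ContinuousOn (fun a : ℝ => a ^ 3 - a ^ 2 - a - 1) (Set.Icc 1.83 1.84) := by fun_prop
  have := intermediate_value_Ioo (by norm_num) hc
  obtain ⟨a, ha, h0⟩ := this (show (0 : ℝ) ∈ _ by constructor <;> norm_num)
  exact ⟨a, by simp only at h0; linarith, ha.1, ha.2⟩

noncomputable def al : ℝ := Classical.choose exists_al
theorem al_eq : al ^ 3 = al ^ 2 + al + 1 := (Classical.choose_spec exists_al).1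
theorem al_gt : 1.83 < al := (Classical.choose_spec exists_al).2.1
theorem al_lt : al < 1.84 := (Classical.choose_spec exists_al).2.2
theorem al_pos : 0 < al := by linarith [al_gt]

noncomputable def be : ℂ := ⟨(1 - al) / 2, Real.sqrt (1 / al - (1 - al) ^ 2 / 4)⟩
noncomputable def ga : ℂ := ⟨(1 - al) / 2, -Real.sqrt (1 / al - (1 - al) ^ 2 / 4)⟩

theorem aux_pos : 0.3 < 1 / al - (1 - al) ^ 2 / 4 := by
  have h1 : 1 / 1.84 < 1 / al := one_div_lt_one_div_of_lt al_pos al_lt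
  have h2 : (1 - al) ^ 2 < 0.84 ^ 2 := by
    rw [sq_lt_sq, abs_lt]; rw [abs_of_pos (by norm_num : (0:ℝ) < 0.84)]
    constructor <;> linarith [al_gt, al_lt]
  norm_num at h1 h2 ⊢
  linarith

theorem ga_conj : ga = (starRingEnd ℂ) be := by
  apply Complex.ext <;> simp [be, ga]
theorem be_conj : be = (starRingEnd ℂ) ga := by
  apply Complex.ext <;> simp [be, ga]

theorem sum1 : (al : ℂ) + be + ga = 1 := by
  apply Complex.ext <;> simp [be, ga]; ring

theorem be_mul_ga : be * ga = 1 / (al : ℂ) := by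
  have h := Real.mul_self_sqrt (show 0 ≤ 1 / al - (1 - al) ^ 2 / 4 by linarith [aux_pos])
  have : (1 / (al : ℂ)) = ((1 / al : ℝ) : ℂ) := by push_cast; rfl
  rw [this]
  apply Complex.ext
  · simp only [be, ga, Complex.mul_re, Complex.ofReal_re]
    linarith
  · simp [be, ga]; ring

theorem al_ne : (al : ℂ) ≠ 0 := by exact_mod_cast al_pos.ne'
theorem prod1 : (al : ℂ) * be * ga = 1 := by
  rw [mul_assoc, be_mul_ga, mul_one_div_cancel al_ne]
theorem al_eqC : (al : ℂ) ^ 3 = al ^ 2 + al + 1 := by exact_mod_cast al_eq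
theorem sum2 : (al : ℂ) * be + be * ga + ga * al = -1 := by
  have h : (al : ℂ) * ((al : ℂ) * be + be * ga + ga * al + 1) = 0 := by
    linear_combination -al_eqC + prod1 + (al : ℂ) ^ 2 * sum1
  rcases mul_eq_zero.1 h with h | h
  · exact absurd h al_ne
  · linear_combination h
theorem factC (x : ℂ) : x ^ 3 - x ^ 2 - x - 1 = (x - al) * (x - be) * (x - ga) := by
  linear_combination -x ^ 2 * sum1 + x * sum2 + prod1 * (-1) + 2 * x^2 * sum1 - 2 * x * sum2 + 2 * prod1
theorem be_eq : be ^ 3 = be ^ 2 + be + 1 := by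
  have := factC be; rw [sub_self, mul_zero, zero_mul] at this; linear_combination this
theorem ga_eq : ga ^ 3 = ga ^ 2 + ga + 1 := by
  have := factC ga; rw [sub_self, mul_zero] at this; linear_combination this

theorem norm_be_ga : ‖be‖ = ‖ga‖ := by rw [ga_conj, Complex.norm_conj]
theorem norm_be_sq : ‖be‖ ^ 2 = 1 / al := by
  have : ‖be * ga‖ = ‖(1 : ℂ) / al‖ := by rw [be_mul_ga]
  rw [norm_mul, ← norm_be_ga, norm_div, norm_one, Complex.norm_real, Real.norm_eq_abs,
    abs_of_pos al_pos] at this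
  rw [sq, this]
theorem norm_be_lt : ‖be‖ < 1 := by
  have h := norm_be_sq
  have : 1 / al < 1 := by rw [div_lt_one al_pos]; linarith [al_gt]
  nlinarith [norm_nonneg be]
theorem norm_be_pos : 0 < ‖be‖ := by
  have h := norm_be_sq
  have : 0 < 1 / al := by have := al_pos; positivity
  rcases (norm_nonneg be).lt_or_eq with h1 | h1
  · exact h1
  · rw [← h1] at h; norm_num at h; linarith [al_pos, inv_pos.2 al_pos]
theorem be_ne : be ≠ 0 := norm_pos_iff.1 norm_be_pos
theorem ga_ne : ga ≠ 0 := norm_pos_iff.1 (norm_be_ga ▸ norm_be_pos)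

/-- the quadratic `E`. -/
def qE {R : Type*} [CommRing R] (x : R) : R := 2 + 18 * x - 8 * x ^ 2
def qD {R : Type*} [CommRing R] (x : R) : R := 3 * x ^ 2 - 2 * x - 1

theorem qDE {R : Type*} [CommRing R] {x : R} (h : x ^ 3 = x ^ 2 + x + 1) : qD x * qE x = 44 := by
  unfold qD qE
  linear_combination (46 - 24 * x) * h

theorem binet (n : ℕ) : (44 : ℂ) * T n = qE (al : ℂ) * al ^ n + qE be * be ^ n + qE ga * ga ^ n := by
  have hg : ga = 1 - al - be := by linear_combination sum1
  have h2 := sum2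
  have h3 := prod1
  induction n using Nat.strong_induction_on with
  | _ n ih =>
    match n with
    | 0 =>
      simp only [T, qE, hg] at *
      push_cast
      linear_combination -16 * h2
    | 1 =>
      simp only [T, qE, hg] at *
      push_cast
      linear_combination 12 * h2 + 24 * h3
    | 2 =>
      simp only [T, qE]
      have := al_eqC
      have := be_eq
      have := ga_eq
      simp only [hg] at *
      grind
    | n + 3 =>
      have a0 := ih n (by omega)
      have a1 := ih (n + 1) (by omega)
      have a2 := ih (n + 2) (by omega)
      simp only [T]
      push_cast
      have h1 := al_eqC
      have h4 := be_eq
      have h5 := ga_eq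
      linear_combination a0 + a1 + a2 - qE (al : ℂ) * al ^ n * h1 - qE be * be ^ n * h4 - qE ga * ga ^ n * h5

open Polynomial in
noncomputable def fQ : ℚ[X] := X ^ 3 - X ^ 2 - X - 1
open Polynomial in
theorem fQ_monic : fQ.Monic := by unfold fQ; monicity!
open Polynomial in
theorem fQ_deg : fQ.natDegree = 3 := by unfold fQ; compute_degree!
open Polynomial in
theorem fQ_irr : Irreducible fQ := by
  have hz : (X ^ 3 - X ^ 2 - X - 1 : ℤ[X]).Monic := by monicity!
  have hm : (X ^ 3 - X ^ 2 - X - 1 : ℤ[X]).map (algebraMap ℤ ℚ) = fQ := by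
    simp [fQ]
  rw [← hm, ← Polynomial.Monic.irreducible_iff_irreducible_map_fraction_map hz]
  have h3 : (X ^ 3 - X ^ 2 - X - 1 : (ZMod 3)[X]).Monic := by monicity!
  have hd3 : (X ^ 3 - X ^ 2 - X - 1 : (ZMod 3)[X]).natDegree = 3 := by compute_degree!
  have key : ∀ a : ZMod 3, a ^ 3 - a ^ 2 - a - 1 ≠ 0 := by decide
  have : Fact (Nat.Prime 3) := ⟨by norm_num⟩
  apply Polynomial.Monic.irreducible_of_irreducible_map (Int.castRingHom (ZMod 3)) _ hz
  have : (X ^ 3 - X ^ 2 - X - 1 : ℤ[X]).map (Int.castRingHom (ZMod 3)) = X ^ 3 - X ^ 2 - X - 1 := by simp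
  rw [this, Polynomial.Monic.irreducible_iff_roots_eq_zero_of_degree_le_three h3 (by omega) (by omega)]
  rw [Multiset.eq_zero_iff_forall_notMem]
  intro a ha
  have := (Polynomial.mem_roots'.1 ha).2
  simp only [IsRoot, eval_sub, eval_pow, eval_X, eval_one] at this
  exact key a this

open Polynomial in
theorem minpoly_al : minpoly ℚ (al : ℂ) = fQ := by
  symm
  apply minpoly.eq_of_irreducible_of_monic fQ_irr _ fQ_monic
  simp [fQ]; linear_combination al_eqC
open Polynomial in
theorem minpoly_be : minpoly ℚ be = fQ := by
  symm
  apply minpoly.eq_of_irreducible_of_monic fQ_irr _ fQ_monic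
  simp [fQ]; linear_combination be_eq
open Polynomial in
theorem conj_be (P : ℤ[X]) (h : aeval (al : ℂ) P = 0) : aeval be P = 0 := by
  have h1 : aeval (al : ℂ) (P.map (algebraMap ℤ ℚ)) = 0 := by
    rw [aeval_map_algebraMap, h]
  have := minpoly.dvd ℚ (al : ℂ) h1
  rw [minpoly_al] at this
  obtain ⟨Q, hQ⟩ := this
  rw [← aeval_map_algebraMap ℚ, hQ, ← minpoly_be, map_mul, minpoly.aeval, zero_mul]
theorem root_cases {x : ℂ} (h : x ^ 3 = x ^ 2 + x + 1) : x = al ∨ x = be ∨ x = ga := by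
  have := factC x
  rw [show x ^ 3 - x ^ 2 - x - 1 = 0 by linear_combination h] at this
  rcases mul_eq_zero.1 this.symm with h | h
  · rcases mul_eq_zero.1 h with h | h
    · left; linear_combination h
    · right; left; linear_combination h
  · right; right; linear_combination h

theorem leib (g : ℂ → ℂ) (hg : Differentiable ℂ g) (c : ℂ) (t : ℕ) :
    iteratedDeriv t (fun x => (x - c) * g x) =
      fun x => (x - c) * iteratedDeriv t g x + t * iteratedDeriv (t - 1) g x := by
  have hd : ∀ t, Differentiable ℂ (iteratedDeriv t g) := fun t =>
    (hg.contDiff (n := ⊤)).differentiable_iteratedDeriv t (by exact_mod_cast WithTop.coe_lt_top _)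
  induction t with
  | zero => simp
  | succ t ih =>
    rw [iteratedDeriv_succ, ih]
    funext x
    have e1 : HasDerivAt (fun x => (x - c) * iteratedDeriv t g x)
        (1 * iteratedDeriv t g x + (x - c) * deriv (iteratedDeriv t g) x) x :=
      ((hasDerivAt_id x).sub_const c).mul (hd t x).hasDerivAt
    have e2 : HasDerivAt (fun x => (t : ℂ) * iteratedDeriv (t - 1) g x)
        (t * deriv (iteratedDeriv (t - 1) g) x) x := (hd (t - 1) x).hasDerivAt.const_mul _
    rw [(e1.fun_add e2).deriv, iteratedDeriv_succ]
    cases t with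
    | zero => simp; ring
    | succ t =>
      simp only [Nat.add_sub_cancel, ← iteratedDeriv_succ]
      push_cast; ring

theorem schwarz_approx (S M : ℕ) (R ρ : ℝ) (z : ℂ) (hS : (S : ℝ) < R) (hz : ‖z‖ ≤ R) (hρ1 : 1 ≤ ρ)
    (hρ : ∀ c : ℕ, c < S → ‖z - c‖ ≤ ρ) :
    ∀ (w : ℕ) (μ : ℕ → ℕ) (f : ℂ → ℂ) (G ε : ℝ), Differentiable ℂ f → (∀ l, μ l ≤ M) →
      ∑ l ∈ Finset.range S, μ l = w →
      (∀ l < S, ∀ t < μ l, ‖iteratedDeriv t f (l : ℂ)‖ ≤ ε * t.factorial) →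
      (∀ x : ℂ, ‖x‖ ≤ R → ‖f x‖ ≤ G) → 0 ≤ ε →
      ‖f z‖ ≤ G * (2 * ρ / (R - S)) ^ w + ε * ((M + 3) * ρ) ^ w := by
  intro w
  induction w with
  | zero =>
    intro μ f G ε hf hM hw hd hG he
    simp only [pow_zero, mul_one]
    linarith [hG z hz]
  | succ w ih =>
    intro μ f G ε hf hM hw hd hG he
    have hex : ∃ c < S, 0 < μ c := by
      by_contra! hcon
      have : ∑ l ∈ Finset.range S, μ l = 0 :=
        Finset.sum_eq_zero fun l hl => by have := hcon l (Finset.mem_range.1 hl); omega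
      omega
    obtain ⟨c, hcS, hc⟩ := hex
    have hcS' : (c : ℝ) < S := by exact_mod_cast hcS
    set g : ℂ → ℂ := dslope f c with hgdef
    have hg : Differentiable ℂ g := by
      have := (Complex.differentiableOn_dslope (f := f) (s := Set.univ) (c := (c : ℂ)) Filter.univ_mem).2
        hf.differentiableOn
      exact differentiableOn_univ.1 this
    have hfg : ∀ x, f x = f c + (x - c) * g x := by
      intro x
      have := sub_smul_dslope f (c : ℂ) x
      rw [smul_eq_mul] at this
      rw [hgdef, this]; ring
    have hder : ∀ t x, iteratedDeriv t f x = (if t = 0 then f c else 0) +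
        ((x - c) * iteratedDeriv t g x + t * iteratedDeriv (t - 1) g x) := by
      intro t x
      have h1 : f = fun x => f c + (x - c) * g x := funext hfg
      have hL := congrFun (leib g hg c t) x
      rw [← hL]
      rcases t with _ | t
      · simp; exact hfg x
      · conv_lhs => rw [h1]
        rw [iteratedDeriv_succ', iteratedDeriv_succ']
        simp
    have hfc : ‖f c‖ ≤ ε := by simpa using hd c hcS 0 hc
    have hfcG : ‖f c‖ ≤ G := hG c (by rw [Complex.norm_natCast]; linarith)
    have hG0 : 0 ≤ G := (norm_nonneg _).trans hfcG
    have hRS : 0 < R - S := by linarith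
    set μ' : ℕ → ℕ := fun l => if l = c then μ l - 1 else μ l with hμ'
    have hgz := ih μ' g (2 * G / (R - S)) ((M + 2) * ε) hg
      (fun l => by simp only [hμ']; split_ifs <;> have := hM l <;> omega)
      (by
        have e1 : ∑ l ∈ Finset.range S, μ l = ∑ l ∈ Finset.range S, μ' l + 1 := by
          rw [← Finset.add_sum_erase _ _ (Finset.mem_range.2 hcS),
            ← Finset.add_sum_erase _ μ' (Finset.mem_range.2 hcS)]
          have : ∑ l ∈ (Finset.range S).erase c, μ l = ∑ l ∈ (Finset.range S).erase c, μ' l :=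
            Finset.sum_congr rfl fun l hl => by simp [hμ', (Finset.mem_erase.1 hl).1]
          rw [this]; simp only [hμ', if_true]; omega
        omega)
      (by
        intro l hl t ht
        by_cases hlc : l = c
        · subst hlc
          simp only [hμ', if_true] at ht
          have h1 := hd l hl (t + 1) (by omega)
          rw [hder] at h1
          simp only [sub_self, zero_mul, Nat.add_sub_cancel, Nat.succ_ne_zero, if_false, zero_add,
            norm_mul, Nat.factorial_succ, Nat.cast_mul] at h1
          rw [Complex.norm_natCast] at h1
          have h2 : (0 : ℝ) < ((t + 1 : ℕ) : ℝ) := by positivity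
          have h3 : ‖iteratedDeriv t g l‖ ≤ ε * t.factorial := by
            have : ((t + 1 : ℕ) : ℝ) * ‖iteratedDeriv t g l‖ ≤ ((t + 1 : ℕ) : ℝ) * (ε * t.factorial) := by linarith
            exact le_of_mul_le_mul_left this h2
          refine h3.trans ?_
          gcongr
          have : (0 : ℝ) ≤ M := by positivity
          nlinarith
        · simp only [hμ', hlc, if_false] at ht
          have hl1 : 1 ≤ ‖(l : ℂ) - c‖ := by
            have : ((l : ℂ) - c) = (((l : ℤ) - c : ℤ) : ℂ) := by push_cast; rfl
            rw [this, Complex.norm_intCast]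
            have : (1 : ℤ) ≤ |(l : ℤ) - c| := Int.one_le_abs (by omega)
            exact_mod_cast this
          have key : ∀ t, t < μ l → ‖iteratedDeriv t g l‖ ≤ (t + 2) * ε * t.factorial := by
            intro t
            induction t with
            | zero =>
              intro ht
              have h0 := hd l hl 0 ht
              have h1 := hder 0 l
              simp only [if_true, Nat.cast_zero, zero_mul, add_zero] at h1
              have h2 : ((l : ℂ) - c) * iteratedDeriv 0 g l = iteratedDeriv 0 f l - f c := by
                rw [h1]; ring
              have h3 : ‖((l : ℂ) - c) * iteratedDeriv 0 g l‖ ≤ ε + ε := by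
                rw [h2]; refine (norm_sub_le _ _).trans ?_
                simp only [Nat.factorial_zero, Nat.cast_one, mul_one] at h0
                linarith
              rw [norm_mul] at h3
              have := le_mul_of_one_le_left (norm_nonneg (iteratedDeriv 0 g l)) hl1
              simp; simp at this h3; linarith
            | succ t iht =>
              intro ht
              have h0 := hd l hl (t + 1) ht
              have h1 := hder (t + 1) l
              have h4 := iht (by omega)
              simp only [Nat.succ_ne_zero, if_false, zero_add, Nat.add_sub_cancel] at h1
              have h2 : ((l : ℂ) - c) * iteratedDeriv (t + 1) g l =
                  iteratedDeriv (t + 1) f l - ((t + 1 : ℕ) : ℂ) * iteratedDeriv t g l := by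
                rw [h1]; ring
              have h3 : ‖((l : ℂ) - c) * iteratedDeriv (t + 1) g l‖ ≤
                  ε * (t + 1).factorial + ((t + 1 : ℕ) : ℝ) * ((t + 2) * ε * t.factorial) := by
                rw [h2]; refine (norm_sub_le _ _).trans ?_
                rw [norm_mul, Complex.norm_natCast]
                gcongr
              rw [norm_mul] at h3
              have := le_mul_of_one_le_left (norm_nonneg (iteratedDeriv (t + 1) g l)) hl1
              refine (this.trans h3).trans (le_of_eq ?_)
              rw [Nat.factorial_succ]; push_cast; ring
          refine (key t ht).trans ?_
          have : (t : ℝ) ≤ M := by have := hM l; exact_mod_cast (by omega : t ≤ M)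
          gcongr)
      (by
        have hbd : ∀ x : ℂ, ‖x‖ = R → ‖g x‖ ≤ 2 * G / (R - S) := by
          intro x hx
          have h1 : R - S ≤ ‖x - c‖ := by
            have := norm_sub_norm_le x (c : ℂ)
            rw [Complex.norm_natCast] at this
            linarith
          have h2 : ‖(x - c) * g x‖ ≤ 2 * G := by
            have : (x - c) * g x = f x - f c := by rw [hfg x]; ring
            rw [this]; refine (norm_sub_le _ _).trans ?_
            linarith [hG x hx.le]
          rw [norm_mul] at h2
          rw [le_div_iff₀ hRS]
          nlinarith [norm_nonneg (g x)]
        intro x hx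
        have hR : 0 < R := lt_of_le_of_lt (Nat.cast_nonneg S) hS
        refine Complex.norm_le_of_forall_mem_frontier_norm_le (U := Metric.ball 0 R) Metric.isBounded_ball
          hg.diffContOnCl ?_ ?_
        · intro y hy
          rw [frontier_ball _ hR.ne'] at hy
          exact hbd y (by simpa using hy)
        · rw [closure_ball _ hR.ne']; simpa using hx)
      (by positivity)
    rw [hfg z]
    have h5 : ‖(z - c) * g z‖ ≤ ρ * (2 * G / (R - S) * (2 * ρ / (R - S)) ^ w + (M + 2) * ε * ((M + 3) * ρ) ^ w) := by
      rw [norm_mul]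
      exact mul_le_mul (hρ c hcS) hgz (norm_nonneg _) (by linarith)
    refine (norm_add_le _ _).trans ?_
    have h6 : 1 ≤ ((M + 3) * ρ) ^ w * ρ := by
      have : 1 ≤ ((M + 3) * ρ) ^ w := one_le_pow₀ (by nlinarith [(Nat.cast_nonneg M : (0:ℝ) ≤ M)])
      nlinarith
    have h7 : ε ≤ ε * (((M + 3) * ρ) ^ w * ρ) := le_mul_of_one_le_right he h6
    calc _ ≤ ε * (((M + 3) * ρ) ^ w * ρ) + ρ * (2 * G / (R - S) * (2 * ρ / (R - S)) ^ w + (M + 2) * ε * ((M + 3) * ρ) ^ w) := by linarith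
      _ = _ := by rw [pow_succ, pow_succ]; ring

theorem liouville_field (F : IntermediateField ℚ ℂ) [FiniteDimensional ℚ F] (x : F) (hx : IsIntegral ℤ x)
    (hx0 : x ≠ 0) (H : ℝ) (hH1 : 1 ≤ H) (hH : ∀ φ : F →ₐ[ℚ] ℂ, ‖φ x‖ ≤ H)
    (hcard : Fintype.card (F →ₐ[ℚ] ℂ) ≤ 18) : 1 ≤ ‖(x : ℂ)‖ * H ^ 17 := by
  classical
  have h1 := Algebra.norm_eq_prod_embeddings ℚ ℂ x
  have h2 : IsIntegral ℤ (Algebra.norm ℚ x) := Algebra.isIntegral_norm ℚ hx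
  obtain ⟨m, hm⟩ := IsIntegrallyClosed.isIntegral_iff.1 h2
  have h3 : Algebra.norm ℚ x ≠ 0 := Algebra.norm_ne_zero_iff.2 hx0
  rw [← hm] at h1 h3
  have hm0 : m ≠ 0 := by rintro rfl; simp at h3
  have h4 : (1 : ℝ) ≤ ‖(algebraMap ℚ ℂ) ((algebraMap ℤ ℚ) m)‖ := by
    have : (algebraMap ℚ ℂ) ((algebraMap ℤ ℚ) m) = (m : ℂ) := by simp
    rw [this, Complex.norm_intCast]
    exact_mod_cast Int.one_le_abs hm0
  obtain ⟨ψ, hψ⟩ : ∃ ψ : F →ₐ[ℚ] ℂ, ψ x = (x : ℂ) := ⟨F.val, rfl⟩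
  rw [h1, norm_prod, ← Finset.mul_prod_erase Finset.univ (fun b : F →ₐ[ℚ] ℂ => ‖b x‖) (Finset.mem_univ ψ), hψ] at h4
  refine h4.trans ?_
  have h5 : ∏ φ ∈ (Finset.univ : Finset (F →ₐ[ℚ] ℂ)).erase ψ, ‖φ x‖ ≤ H ^ 17 := by
    refine (Finset.prod_le_prod (fun _ _ => norm_nonneg _) fun φ _ => hH φ).trans ?_
    rw [Finset.prod_const, Finset.card_erase_of_mem (Finset.mem_univ _), Finset.card_univ]
    exact pow_le_pow_right₀ hH1 (by omega)
  exact mul_le_mul_of_nonneg_left h5 (norm_nonneg _)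

theorem norm_root_le {x : ℂ} (h : x ^ 3 = x ^ 2 + x + 1) : ‖x‖ ≤ 2 := by
  rcases root_cases h with rfl | rfl | rfl
  · rw [Complex.norm_real, Real.norm_eq_abs, abs_of_pos al_pos]; linarith [al_lt]
  · linarith [norm_be_lt]
  · rw [← norm_be_ga]; linarith [norm_be_lt]

theorem norm_qD_le {x : ℂ} (h : ‖x‖ ≤ 2) : ‖qD x‖ ≤ 17 := by
  unfold qD
  have h1 : ‖3 * x ^ 2‖ ≤ 12 := by
    rw [norm_mul, norm_pow]; norm_num; nlinarith [norm_nonneg x]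
  have h2 : ‖2 * x‖ ≤ 4 := by rw [norm_mul]; norm_num; linarith
  have := norm_sub_le (3 * x ^ 2 - 2 * x) 1
  have := norm_sub_le (3 * x ^ 2) (2 * x)
  rw [norm_one] at *
  linarith

theorem norm_qE_le {x : ℂ} (h : ‖x‖ ≤ 2) : ‖qE x‖ ≤ 70 := by
  unfold qE
  have h1 : ‖8 * x ^ 2‖ ≤ 32 := by
    rw [norm_mul, norm_pow]; norm_num; nlinarith [norm_nonneg x]
  have h2 : ‖18 * x‖ ≤ 36 := by rw [norm_mul]; norm_num; linarith
  have h3 : ‖(2 : ℂ)‖ = 2 := by norm_num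
  have := norm_sub_le (2 + 18 * x) (8 * x ^ 2)
  have := norm_add_le (2 : ℂ) (18 * x)
  linarith

theorem norm_quad {x v : ℂ} {B : ℝ} (hB : 0 ≤ B) (h : x ^ 2 - v * x + 1 = 0) (hv : ‖v‖ ≤ B) : ‖x‖ ≤ B + 1 := by
  by_contra! hc
  have h1 : x ^ 2 = v * x - 1 := by linear_combination h
  have h2 : ‖x‖ ^ 2 ≤ ‖v‖ * ‖x‖ + 1 := by
    rw [← norm_pow, h1, ← norm_mul]
    refine (norm_sub_le _ _).trans ?_
    simp
  nlinarith [norm_nonneg x]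

open Polynomial in
theorem mem_fRoots (x : ℂ) : x ∈ ({(al : ℂ), be, ga} : Finset ℂ) ↔ x ^ 3 = x ^ 2 + x + 1 := by
  simp only [Finset.mem_insert, Finset.mem_singleton]
  refine ⟨?_, root_cases⟩
  rintro (rfl | rfl | rfl)
  exacts [al_eqC, be_eq, ga_eq]

/-- the field generated by everything. -/
noncomputable def fld (χ : ℂ) : IntermediateField ℚ ℂ := IntermediateField.adjoin ℚ {(al : ℂ), be, χ}
noncomputable def fal (χ : ℂ) : fld χ := ⟨al, IntermediateField.subset_adjoin _ _ (by simp)⟩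
noncomputable def fbe (χ : ℂ) : fld χ := ⟨be, IntermediateField.subset_adjoin _ _ (by simp)⟩
noncomputable def fch (χ : ℂ) : fld χ := ⟨χ, IntermediateField.subset_adjoin _ _ (by simp)⟩

open Polynomial in
theorem cubic_integral {R : Type*} [CommRing R] {x : R} (h : x ^ 3 = x ^ 2 + x + 1) : IsIntegral ℤ x :=
  ⟨X ^ 3 - X ^ 2 - X - 1, by monicity!, by simp; rw [h]; ring⟩

open Polynomial in
theorem quad_integral {R : Type*} [CommRing R] [IsDomain R] {x v : R} (hv : IsIntegral ℤ v)
    (h : x ^ 2 - v * x + 1 = 0) : IsIntegral ℤ x := by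
  let v' : integralClosure ℤ R := ⟨v, hv⟩
  have : IsIntegral (integralClosure ℤ R) x :=
    ⟨X ^ 2 - C v' * X + 1, by monicity!, by
      simp only [eval₂_add, eval₂_sub, eval₂_mul, eval₂_pow, eval₂_X, eval₂_C, eval₂_one]; exact h⟩
  exact isIntegral_trans (R := ℤ) (A := integralClosure ℤ R) x this

theorem aeval_integral {R : Type*} [CommRing R] {x : R} (hx : IsIntegral ℤ x) (P : Polynomial ℤ) :
    IsIntegral ℤ (Polynomial.aeval x P) := by
  have := (Polynomial.aeval (⟨x, hx⟩ : integralClosure ℤ R) P).2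
  rw [Polynomial.aeval_subalgebra_coe] at this
  exact this

section
variable (P : Polynomial ℤ) (χ : ℂ) (hχ : χ ^ 2 - Polynomial.aeval (al : ℂ) P * χ + 1 = 0)
include hχ

theorem chi_integral : IsIntegral ℤ χ :=
  quad_integral (aeval_integral (cubic_integral al_eqC) P) hχ

theorem fld_fin : FiniteDimensional ℚ (fld χ) := by
  apply IntermediateField.finiteDimensional_adjoin
  intro x hx
  simp only [Set.mem_insert_iff, Set.mem_singleton_iff] at hx
  have h : IsIntegral ℤ x := by
    rcases hx with rfl | rfl | rfl
    exacts [cubic_integral al_eqC, cubic_integral be_eq, chi_integral P _ hχ]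
  exact h.tower_top

omit hχ in
theorem fal_eq : (fal χ) ^ 3 = (fal χ) ^ 2 + fal χ + 1 := Subtype.ext (by simpa [fal] using al_eqC)
omit hχ in
theorem fbe_eq : (fbe χ) ^ 3 = (fbe χ) ^ 2 + fbe χ + 1 := Subtype.ext (by simpa [fbe] using be_eq)
omit hχ in
theorem aeval_coe (Q : Polynomial ℤ) (F : IntermediateField ℚ ℂ) (x : F) :
    ((Polynomial.aeval x Q : F) : ℂ) = Polynomial.aeval (x : ℂ) Q := by
  have := Polynomial.aeval_algHom_apply (F.val.restrictScalars ℤ) x Q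
  simpa using this.symm
omit hχ in
theorem map_aeval (F : IntermediateField ℚ ℂ) (φ : F →ₐ[ℚ] ℂ) (x : F) :
    φ (Polynomial.aeval x P) = Polynomial.aeval (φ x) P := by
  have := Polynomial.aeval_algHom_apply (φ.restrictScalars ℤ) x P
  simpa using this.symm
theorem fch_eq : (fch χ) ^ 2 - Polynomial.aeval (fal χ) P * fch χ + 1 = 0 := by
  apply Subtype.ext
  have := aeval_coe P _ (fal χ)
  push_cast
  rw [this]
  exact hχ

omit hχ in
theorem phi_al (φ : fld χ →ₐ[ℚ] ℂ) : (φ (fal χ)) ^ 3 = (φ (fal χ)) ^ 2 + φ (fal χ) + 1 := by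
  have := congrArg φ (fal_eq χ); simpa using this
omit hχ in
theorem phi_be (φ : fld χ →ₐ[ℚ] ℂ) : (φ (fbe χ)) ^ 3 = (φ (fbe χ)) ^ 2 + φ (fbe χ) + 1 := by
  have := congrArg φ (fbe_eq χ); simpa using this
theorem phi_ch (φ : fld χ →ₐ[ℚ] ℂ) :
    (φ (fch χ)) ^ 2 - Polynomial.aeval (φ (fal χ)) P * φ (fch χ) + 1 = 0 := by
  have := congrArg φ (fch_eq P χ hχ)
  rw [← map_aeval P]
  simpa using this

open Polynomial in
theorem fld_card [FiniteDimensional ℚ (fld χ)] : Fintype.card (fld χ →ₐ[ℚ] ℂ) ≤ 18 := by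
  classical
  let s : Finset ℂ := {(al : ℂ), be, ga}
  have hs : s.card ≤ 3 := Finset.card_le_three
  let t : ℂ → Finset ℂ := fun a => (X ^ 2 - C (aeval a P) * X + 1 : ℂ[X]).roots.toFinset
  have hmon : ∀ a : ℂ, (X ^ 2 - C (aeval a P) * X + 1 : ℂ[X]).Monic := fun a => by monicity!
  have ht : ∀ a, (t a).card ≤ 2 := by
    intro a
    refine (Multiset.toFinset_card_le _).trans ((Polynomial.card_roots' _).trans ?_)
    compute_degree
  let f : (fld χ →ₐ[ℚ] ℂ) → ℂ × (Σ _ : ℂ, ℂ) := fun φ => (φ (fbe χ), ⟨φ (fal χ), φ (fch χ)⟩)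
  have hf : Function.Injective f := by
    intro φ ψ h
    simp only [f, Prod.mk.injEq, Sigma.mk.injEq, heq_eq_eq] at h
    obtain ⟨h1, h2, h3⟩ := h
    refine IntermediateField.algHom_ext_of_eq_adjoin (S := fld χ) (s := {(al : ℂ), be, χ}) ℚ rfl ?_
    intro x hx
    simp only [Set.mem_insert_iff, Set.mem_singleton_iff] at hx
    rcases hx with rfl | rfl | rfl
    exacts [h2, h1, h3]
  have : Finset.univ.image f ⊆ s ×ˢ (s.sigma t) := by
    intro y hy
    obtain ⟨φ, -, rfl⟩ := Finset.mem_image.1 hy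
    simp only [f, Finset.mem_product, Finset.mem_sigma]
    refine ⟨(mem_fRoots _).2 (phi_be χ φ), (mem_fRoots _).2 (phi_al χ φ), ?_⟩
    rw [Multiset.mem_toFinset, mem_roots (hmon _).ne_zero]
    simpa [IsRoot] using phi_ch P χ hχ φ
  have h2 := Finset.card_le_card this
  rw [Finset.card_image_of_injective _ hf, Finset.card_univ, Finset.card_product, Finset.card_sigma] at h2
  have h3 : ∑ a ∈ s, (t a).card ≤ s.card * 2 := Finset.sum_le_card_nsmul _ _ _ fun a _ => ht a
  calc _ ≤ _ := h2
    _ ≤ 3 * (3 * 2) := Nat.mul_le_mul hs (h3.trans (by omega))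

end

theorem liouville (n : ℝ) (hn : 10 ≤ n) (P : Polynomial ℤ)
    (hP : ∀ ρ : ℂ, ρ ^ 3 = ρ ^ 2 + ρ + 1 → ‖Polynomial.aeval ρ P‖ ≤ Real.exp n) (χ : ℂ)
    (hχ : χ ^ 2 - Polynomial.aeval (al : ℂ) P * χ + 1 = 0) {ι : Type*} (s : Finset ι) (c : ι → ℤ)
    (i j : ι → ℕ) (D : ℕ) (hi : ∀ a ∈ s, i a ≤ D) (hj : ∀ a ∈ s, j a ≤ D) (H : ℝ) (hH1 : 1 ≤ H)
    (hH : ∑ a ∈ s, |(c a : ℝ)| ≤ H)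
    (hne : ∑ a ∈ s, (c a : ℂ) * (al * be ^ 2) ^ i a * (χ * (qD be * qE ga) / 44) ^ j a ≠ 0) :
    1 ≤ ‖∑ a ∈ s, (c a : ℂ) * (al * be ^ 2) ^ i a * (χ * (qD be * qE ga) / 44) ^ j a‖ *
      (H * Real.exp (3 * n * D)) ^ 18 := by
  set F := fld χ
  have : FiniteDimensional ℚ F := fld_fin P χ hχ
  set a' : F := fal χ
  set b' : F := fbe χ
  set x' : F := fch χ
  have ia : IsIntegral ℤ a' := cubic_integral (fal_eq χ)
  have ib : IsIntegral ℤ b' := cubic_integral (fbe_eq χ)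
  have ix : IsIntegral ℤ x' := quad_integral (aeval_integral ia P) (fch_eq P χ hχ)
  have inat : ∀ m : ℤ, IsIntegral ℤ (m : F) := fun m => by
    simpa using (isIntegral_algebraMap (R := ℤ) (A := F) (x := m))
  set tt : F := x' * (qD b' * qE (1 - a' - b')) with htt
  have itt : IsIntegral ℤ tt := by
    have i1 : IsIntegral ℤ (qD b') := by
      have := ((inat 3).mul (ib.pow 2)).sub ((inat 2).mul ib) |>.sub (inat 1)
      simpa [qD] using this
    have ic : IsIntegral ℤ (1 - a' - b') := by
      have := ((inat 1).sub ia).sub ib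
      simpa using this
    have i2 : IsIntegral ℤ (qE (1 - a' - b')) := by
      have := ((inat 2).add ((inat 18).mul ic)).sub ((inat 8).mul (ic.pow 2))
      simpa [qE] using this
    exact ix.mul (i1.mul i2)
  set x : F := ∑ a ∈ s, (c a : F) * (a' * b' ^ 2) ^ i a * tt ^ j a * (44 : ℤ) ^ (D - j a) with hxdef
  have hx : IsIntegral ℤ x := by
    apply IsIntegral.sum
    intro a _
    exact (((inat _).mul ((ia.mul (ib.pow 2)).pow _)).mul (itt.pow _)).mul ((inat 44).pow _)
  have hga : ga = 1 - al - be := by linear_combination sum1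
  have hval : (x : ℂ) = 44 ^ D * ∑ a ∈ s, (c a : ℂ) * (al * be ^ 2) ^ i a * (χ * (qD be * qE ga) / 44) ^ j a := by
    rw [Finset.mul_sum]
    have e1 : F.val tt = χ * (qD be * qE ga) := by
      simp only [htt, map_mul, hga, qD, qE, map_sub, map_add, map_pow, map_one, map_ofNat]
      rfl
    have e2 : F.val a' = al := rfl
    have e3 : F.val b' = be := rfl
    rw [show (x : ℂ) = F.val x from rfl, hxdef, map_sum]
    refine Finset.sum_congr rfl fun a ha => ?_
    simp only [map_mul, map_pow, e1, e2, e3, map_intCast]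
    obtain ⟨r, hr⟩ := Nat.exists_eq_add_of_le (hj a ha)
    rw [hr, Nat.add_sub_cancel_left, div_pow, pow_add]
    push_cast
    field_simp
  have hx0 : x ≠ 0 := by
    intro h
    rw [h] at hval
    have := hval.symm
    simp only [ZeroMemClass.coe_zero, mul_eq_zero] at this
    rcases this with h | h
    · exact absurd h (pow_ne_zero _ (by norm_num))
    · exact hne h
  have hE : (0 : ℝ) < Real.exp n := Real.exp_pos n
  have hE1 : (1 : ℝ) ≤ Real.exp n := Real.one_le_exp (by linarith)
  have hphi : ∀ φ : F →ₐ[ℚ] ℂ, ‖φ x‖ ≤ H * (8 ^ D * (2400 * Real.exp n) ^ D * 44 ^ D) := by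
    intro φ
    have ha2 := norm_root_le (phi_al χ φ)
    have hb2 := norm_root_le (phi_be χ φ)
    have hg8 : ‖φ (a' * b' ^ 2)‖ ≤ 8 := by
      rw [map_mul, map_pow, norm_mul, norm_pow]
      calc _ ≤ (2 : ℝ) * 2 ^ 2 := by gcongr
        _ = 8 := by norm_num
    have hc3 : (φ (1 - a' - b')) ^ 3 = (φ (1 - a' - b')) ^ 2 + φ (1 - a' - b') + 1 := by
      have : (1 - a' - b') ^ 3 = (1 - a' - b') ^ 2 + (1 - a' - b') + 1 := by
        apply Subtype.ext
        have := ga_eq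
        rw [hga] at this
        exact this
      have := congrArg φ this
      simpa using this
    have ht : ‖φ tt‖ ≤ 2400 * Real.exp n := by
      have e1 : φ tt = φ x' * (qD (φ b') * qE (φ (1 - a' - b'))) := by
        simp only [htt, qD, qE, map_mul, map_sub, map_add, map_pow, map_one, map_ofNat]
      rw [e1, norm_mul, norm_mul]
      have h1 : ‖φ x'‖ ≤ Real.exp n + 1 := norm_quad hE.le (phi_ch P χ hχ φ) (hP _ (phi_al χ φ))
      calc _ ≤ (Real.exp n + 1) * (17 * 70) := by
            gcongr
            · exact norm_qD_le hb2
            · exact norm_qE_le (norm_root_le hc3)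
        _ ≤ _ := by linarith
    rw [hxdef, map_sum]
    refine (norm_sum_le _ _).trans ?_
    refine le_trans ?_ (mul_le_mul_of_nonneg_right hH (by positivity))
    rw [Finset.sum_mul]
    refine Finset.sum_le_sum fun a ha => ?_
    simp only [map_mul φ, map_pow φ, norm_mul, norm_pow, map_intCast]
    rw [← norm_pow, ← norm_mul, ← map_pow φ, ← map_mul φ, Complex.norm_intCast, Complex.norm_intCast, mul_assoc, mul_assoc]
    refine mul_le_mul_of_nonneg_left ?_ (abs_nonneg _)
    have h44 : |((44 : ℤ) : ℝ)| = 44 := by norm_num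
    rw [h44, ← mul_assoc]
    gcongr
    · calc _ ≤ (8 : ℝ) ^ i a := by gcongr
        _ ≤ 8 ^ D := pow_le_pow_right₀ (by norm_num) (hi a ha)
    · calc _ ≤ (2400 * Real.exp n) ^ j a := by gcongr
        _ ≤ _ := pow_le_pow_right₀ (by linarith) (hj a ha)
    · norm_num
    · omega
  have hB : (8 : ℝ) ^ D * (2400 * Real.exp n) ^ D * 44 ^ D ≤ Real.exp (3 * n * D) := by
    rw [← mul_pow, ← mul_pow, mul_comm (3 * n), Real.exp_nat_mul]
    gcongr
    have : Real.exp (3 * n) = Real.exp n * (Real.exp n * Real.exp n) := by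
      rw [← Real.exp_add, ← Real.exp_add]; ring_nf
    rw [this]
    have h10 : (1025 : ℝ) ≤ Real.exp n := by
      have : Real.exp 10 ≤ Real.exp n := Real.exp_le_exp.2 hn
      have h2 : (2.7 : ℝ) ^ 10 ≤ Real.exp 10 := by
        rw [show (10 : ℝ) = (10 : ℕ) * 1 by norm_num, Real.exp_nat_mul]
        gcongr
        linarith [Real.exp_one_gt_d9]
      norm_num at h2
      linarith
    nlinarith
  have hB1 : (44 : ℝ) ^ D ≤ Real.exp (3 * n * D) := by
    refine le_trans ?_ hB
    refine le_mul_of_one_le_left (by positivity) ?_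
    exact one_le_mul_of_one_le_of_one_le (one_le_pow₀ (by norm_num)) (one_le_pow₀ (by linarith))
  set W := Real.exp (3 * n * D) with hW
  have hW1 : 1 ≤ W := Real.one_le_exp (by positivity)
  have hmain := liouville_field F x hx hx0 (H * W) (one_le_mul_of_one_le_of_one_le hH1 hW1)
    (fun φ => (hphi φ).trans (by gcongr)) (fld_card P χ hχ)
  rw [hval, norm_mul, norm_pow] at hmain
  refine hmain.trans ?_
  have : ‖(44 : ℂ)‖ = 44 := by norm_num
  rw [this, pow_succ (H * W) 17]
  set Y := ‖∑ a ∈ s, (c a : ℂ) * (al * be ^ 2) ^ i a * (χ * (qD be * qE ga) / 44) ^ j a‖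
  have h44 : (44 : ℝ) ^ D ≤ H * W := hB1.trans (le_mul_of_one_le_left (by positivity) hH1)
  calc 44 ^ D * Y * (H * W) ^ 17 ≤ (H * W) * Y * (H * W) ^ 17 := by
        gcongr
    _ = _ := by ring

theorem be_ne_ga : be ≠ ga := by
  intro h
  have := congrArg Complex.im h
  simp only [be, ga] at this
  have h2 : 0 < Real.sqrt (1 / al - (1 - al) ^ 2 / 4) := Real.sqrt_pos.2 (by linarith [aux_pos])
  linarith

theorem exists_emb (P : Polynomial ℤ) (χ : ℂ) (hχ : χ ^ 2 - Polynomial.aeval (al : ℂ) P * χ + 1 = 0) :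
    ∃ φ : fld χ →+* ℂ, φ (fbe χ) = al := by
  have : FiniteDimensional ℚ (fld χ) := fld_fin P χ hχ
  have : NumberField (fld χ) := { }
  have h := NumberField.Embeddings.range_eval_eq_rootSet_minpoly (fld χ) ℂ (fbe χ)
  have h2 : (al : ℂ) ∈ (minpoly ℚ (fbe χ)).rootSet ℂ := by
    have e : minpoly ℚ (fbe χ) = fQ := by
      rw [← minpoly_be]
      exact (minpoly.algHom_eq (fld χ).val (fld χ).val.injective (fbe χ)).symm
    rw [e, Polynomial.mem_rootSet]
    refine ⟨fQ_monic.ne_zero, ?_⟩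
    rw [← minpoly_al, minpoly.aeval]
  rw [← h] at h2
  exact h2

theorem qD_ne {x : ℂ} (h : x ^ 3 = x ^ 2 + x + 1) : qD x ≠ 0 := by
  intro h0; have := qDE h; rw [h0] at this; norm_num at this
theorem qE_ne {x : ℂ} (h : x ^ 3 = x ^ 2 + x + 1) : qE x ≠ 0 := by
  intro h0; have := qDE h; rw [h0] at this; norm_num at this

theorem g_eq : (al : ℂ) * be ^ 2 = be / ga := by
  rw [eq_div_iff ga_ne]; linear_combination be * prod1
theorem tau_eq (χ : ℂ) : χ * (qD be * qE ga) / 44 = χ * (qD be / qD ga) := by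
  have h := qDE ga_eq
  have h2 := qD_ne ga_eq
  field_simp
  linear_combination χ * qD be * h

section
variable (P : Polynomial ℤ) (χ : ℂ) (hχ : χ ^ 2 - Polynomial.aeval (al : ℂ) P * χ + 1 = 0)
include hχ

/-- image of gamma under the embedding. -/
theorem emb_ga (φ : fld χ →+* ℂ) (hφ : φ (fbe χ) = al) :
    φ (1 - fal χ - fbe χ) = be ∨ φ (1 - fal χ - fbe χ) = ga := by
  have hga : ga = 1 - al - be := by linear_combination sum1
  have h1 : (1 - fal χ - fbe χ) ^ 3 = (1 - fal χ - fbe χ) ^ 2 + (1 - fal χ - fbe χ) + 1 := by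
    apply Subtype.ext
    have := ga_eq
    rw [hga] at this
    exact this
  have h2 := congrArg φ h1
  simp only [map_pow, map_add, map_one] at h2
  rcases root_cases h2 with h | h | h
  · exfalso
    rw [← hφ] at h
    have := congrArg (Subtype.val) (φ.injective h)
    apply be_ne_ga
    rw [hga]; exact this.symm
  · exact Or.inl h
  · exact Or.inr h

theorem g_pow_ne (m : ℕ) (hm : 0 < m) : be ^ m ≠ ga ^ m := by
  intro h
  have hga : ga = 1 - al - be := by linear_combination sum1
  obtain ⟨φ, hφ⟩ := exists_emb P χ hχ
  have h1 : (fbe χ) ^ m = (1 - fal χ - fbe χ) ^ m := by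
    apply Subtype.ext
    rw [hga] at h
    exact h
  have h2 := congrArg φ h1
  rw [map_pow, map_pow, hφ] at h2
  have h3 : ‖φ (1 - fal χ - fbe χ)‖ < 1 := by
    rcases emb_ga P χ hχ φ hφ with h | h <;> rw [h]
    · exact norm_be_lt
    · rw [← norm_be_ga]; exact norm_be_lt
  have h4 := congrArg norm h2
  rw [norm_pow, norm_pow, Complex.norm_real, Real.norm_eq_abs, abs_of_pos al_pos] at h4
  have h5 : 1 < al ^ m := one_lt_pow₀ (by linarith [al_gt]) hm.ne'
  have h6 : ‖φ (1 - fal χ - fbe χ)‖ ^ m < 1 := pow_lt_one₀ (norm_nonneg _) h3 hm.ne'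
  linarith

omit hχ in
theorem isInt_conj {x : ℂ} (h : IsIntegral ℤ x) : IsIntegral ℤ ((starRingEnd ℂ) x) :=
  h.map ((starRingEnd ℂ).toIntAlgHom)

theorem ratio_not_unit (h1 : IsIntegral ℤ (qD be / qD ga)) (h2 : IsIntegral ℤ (qD ga / qD be)) : False := by
  have hga : ga = 1 - al - be := by linear_combination sum1
  obtain ⟨φ, hφ⟩ := exists_emb P χ hχ
  set b' := fbe χ
  set c' := 1 - fal χ - fbe χ
  have hc' : ((c' : fld χ) : ℂ) = ga := by rw [hga]; rfl
  have dcoe : ∀ y : fld χ, ((qD y : fld χ) : ℂ) = qD (y : ℂ) := fun y => rfl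
  have i1 : IsIntegral ℤ (qD b' / qD c') := by
    rw [← isIntegral_algebraMap_iff (B := ℂ) (algebraMap (fld χ) ℂ).injective]
    rw [map_div₀]
    change IsIntegral ℤ (((qD b' : fld χ) : ℂ) / ((qD c' : fld χ) : ℂ))
    rw [dcoe, dcoe, hc']; exact h1
  have i2 : IsIntegral ℤ (qD c' / qD b') := by
    rw [← isIntegral_algebraMap_iff (B := ℂ) (algebraMap (fld χ) ℂ).injective]
    rw [map_div₀]
    change IsIntegral ℤ (((qD c' : fld χ) : ℂ) / ((qD b' : fld χ) : ℂ))
    rw [dcoe, dcoe, hc']; exact h2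
  have j1 := i1.map φ.toIntAlgHom
  have j2 := i2.map φ.toIntAlgHom
  have dphi : ∀ y : fld χ, φ (qD y) = qD (φ y) := fun y => by
    simp only [qD, map_sub, map_mul, map_pow, map_one, map_ofNat]
  simp only [RingHom.toIntAlgHom_apply, map_div₀, dphi, hφ] at j1 j2
  have dconj : ∀ y : ℂ, (starRingEnd ℂ) (qD y) = qD ((starRingEnd ℂ) y) := fun y => by
    simp only [qD, map_sub, map_mul, map_pow, map_one, map_ofNat]
  have cb : (starRingEnd ℂ) be = ga := ga_conj.symm
  have cg : (starRingEnd ℂ) ga = be := be_conj.symm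
  have ca : (starRingEnd ℂ) (al : ℂ) = al := Complex.conj_ofReal _
  have k1 := isInt_conj j1
  have k2 := isInt_conj j2
  rw [map_div₀, dconj, dconj, ca] at k1 k2
  have all : IsIntegral ℤ (qD (al : ℂ) / qD be) ∧ IsIntegral ℤ (qD (al : ℂ) / qD ga) ∧
      IsIntegral ℤ (qD be / qD (al : ℂ)) ∧ IsIntegral ℤ (qD ga / qD (al : ℂ)) := by
    rcases emb_ga P χ hχ φ hφ with h | h
    · rw [h] at j1 j2
      rw [h, cb] at k1 k2
      exact ⟨j1, k1, j2, k2⟩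
    · rw [h] at j1 j2
      rw [h, cg] at k1 k2
      exact ⟨k1, j1, k2, j2⟩
  obtain ⟨a1, a2, a3, a4⟩ := all
  have na := qD_ne al_eqC
  have nb := qD_ne be_eq
  have nc := qD_ne ga_eq
  have hsum := ((a1.mul a2).add (a3.mul h1)).add (a4.mul h2)
  have hprod : qD (al : ℂ) * qD be * qD ga = 44 := by
    have := al_eqC; have := be_eq; have h2 := sum2; have h3 := prod1
    rw [hga] at h2 h3 ⊢
    unfold qD
    grind
  have cube : ∀ {x : ℂ}, x ^ 3 = x ^ 2 + x + 1 → qD x ^ 3 = 36 + 40 * x + 16 * x ^ 2 := by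
    intro x hx
    unfold qD
    grind
  have hval : qD (al : ℂ) / qD be * (qD (al : ℂ) / qD ga) + qD be / qD (al : ℂ) * (qD be / qD ga) +
      qD ga / qD (al : ℂ) * (qD ga / qD be) = ((49 / 11 : ℚ) : ℂ) := by
    have e : qD (al : ℂ) ^ 3 + qD be ^ 3 + qD ga ^ 3 = 196 := by
      rw [cube al_eqC, cube be_eq, cube ga_eq]
      linear_combination (40 + 16 * (al + be + ga + 1)) * sum1 - 32 * sum2
    have e2 : qD (al : ℂ) / qD be * (qD (al : ℂ) / qD ga) + qD be / qD (al : ℂ) * (qD be / qD ga) +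
      qD ga / qD (al : ℂ) * (qD ga / qD be) = (qD (al : ℂ) ^ 3 + qD be ^ 3 + qD ga ^ 3) / (qD (al : ℂ) * qD be * qD ga) := by
      field_simp
    rw [e2, e, hprod]; push_cast; norm_num
  rw [hval] at hsum
  have hq : IsIntegral ℤ (49 / 11 : ℚ) := by
    rw [← isIntegral_algebraMap_iff (B := ℂ) (algebraMap ℚ ℂ).injective]
    simpa using hsum
  obtain ⟨m, hm⟩ := IsIntegrallyClosed.isIntegral_iff.1 hq
  have : (11 * m : ℚ) = 49 := by
    have hm' : (m : ℚ) = 49 / 11 := by simpa using hm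
    rw [hm']; norm_num
  have : 11 * m = 49 := by exact_mod_cast this
  omega

theorem chi_ne : χ ≠ 0 := by rintro rfl; simp at hχ

theorem chi_inv_integral : IsIntegral ℤ χ⁻¹ := by
  refine quad_integral (aeval_integral (cubic_integral al_eqC) P) ?_
  have h0 := chi_ne P χ hχ
  field_simp
  linear_combination hχ

theorem no_rel (m s t : ℕ) (hm : 0 < m)
    (h : ((al : ℂ) * be ^ 2) ^ s * (χ * (qD be * qE ga) / 44) ^ m = ((al : ℂ) * be ^ 2) ^ t) : False := by
  have ia := cubic_integral al_eqC
  have ib := cubic_integral be_eq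
  have ic := cubic_integral ga_eq
  have ig : IsIntegral ℤ (be / ga) := by rw [← g_eq]; exact ia.mul (ib.pow 2)
  have ig' : IsIntegral ℤ (ga / be) := by
    have : ga / be = al * ga ^ 2 := by
      rw [div_eq_iff be_ne]; linear_combination -ga * prod1
    rw [this]; exact ia.mul (ic.pow 2)
  have hx := chi_integral P χ hχ
  have hx' := chi_inv_integral P χ hχ
  have h0 := chi_ne P χ hχ
  rw [g_eq, tau_eq] at h
  have nb := qD_ne be_eq
  have nc := qD_ne ga_eq
  have hb := be_ne
  have hc := ga_ne
  apply ratio_not_unit P χ hχ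
  · refine IsIntegral.of_pow hm ?_
    have : (qD be / qD ga) ^ m = (be / ga) ^ t * (ga / be) ^ s * χ⁻¹ ^ m := by
      rw [← h, mul_pow, div_pow be ga, div_pow ga be, inv_pow]
      field_simp
    rw [this]
    exact ((ig.pow _).mul (ig'.pow _)).mul (hx'.pow _)
  · refine IsIntegral.of_pow hm ?_
    have : (qD ga / qD be) ^ m = (ga / be) ^ t * (be / ga) ^ s * χ ^ m := by
      have e : (ga / be) ^ t = ((be / ga) ^ t)⁻¹ := by rw [← inv_pow, inv_div]
      rw [e, ← h, mul_pow, div_pow be ga, div_pow (qD be), div_pow (qD ga)]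
      field_simp
    rw [this]
    exact ((ig'.pow _).mul (ig.pow _)).mul (hx.pow _)

theorem indep_le (i j i' j' : ℕ) (hjj : j ≤ j')
    (h : ((al : ℂ) * be ^ 2) ^ i * (χ * (qD be * qE ga) / 44) ^ j =
      ((al : ℂ) * be ^ 2) ^ i' * (χ * (qD be * qE ga) / 44) ^ j') : i = i' ∧ j = j' := by
  have hg0 : (al : ℂ) * be ^ 2 ≠ 0 := mul_ne_zero al_ne (pow_ne_zero _ be_ne)
  have ht0 : χ * (qD be * qE ga) / 44 ≠ 0 :=
    div_ne_zero (mul_ne_zero (chi_ne P χ hχ) (mul_ne_zero (qD_ne be_eq) (qE_ne ga_eq))) (by norm_num)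
  obtain ⟨r, rfl⟩ := Nat.exists_eq_add_of_le hjj
  have h1 : ((al : ℂ) * be ^ 2) ^ i' * (χ * (qD be * qE ga) / 44) ^ r = ((al : ℂ) * be ^ 2) ^ i := by
    apply mul_right_cancel₀ (pow_ne_zero j ht0)
    rw [h, pow_add]; ring
  rcases Nat.eq_zero_or_pos r with rfl | hr
  · refine ⟨?_, rfl⟩
    rw [pow_zero, mul_one] at h1
    have key : ∀ a b : ℕ, a < b → ((al : ℂ) * be ^ 2) ^ a ≠ ((al : ℂ) * be ^ 2) ^ b := by
      intro a b hab he
      obtain ⟨m, rfl⟩ := Nat.exists_eq_add_of_le hab.le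
      have : ((al : ℂ) * be ^ 2) ^ m = 1 := by
        apply mul_left_cancel₀ (pow_ne_zero a hg0)
        rw [← pow_add, ← he, mul_one]
      rw [g_eq, div_pow, div_eq_one_iff_eq (pow_ne_zero _ ga_ne)] at this
      exact g_pow_ne P χ hχ m (by omega) this
    rcases lt_trichotomy i i' with h | h | h
    · exact absurd h1.symm (key _ _ h)
    · exact h
    · exact absurd h1 (key _ _ h)
  · exact (no_rel P χ hχ r i' i hr h1).elim

theorem indep (i j i' j' : ℕ)
    (h : ((al : ℂ) * be ^ 2) ^ i * (χ * (qD be * qE ga) / 44) ^ j =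
      ((al : ℂ) * be ^ 2) ^ i' * (χ * (qD be * qE ga) / 44) ^ j') : i = i' ∧ j = j' := by
  rcases le_total j j' with hj | hj
  · exact indep_le P χ hχ i j i' j' hj h
  · have := indep_le P χ hχ i' j' i j hj h.symm
    exact ⟨this.1.symm, this.2.symm⟩
end

attribute [local instance] Matrix.seminormedAddCommGroup in
theorem siegelC {α ι : Type} [Fintype α] [Fintype ι] (x : α → ι → ℂ) (X Q Y e : ℝ)
    (hx : ∀ a i, ‖x a i‖ ≤ X) (hQ : 1 ≤ Q) (hX : 0 ≤ X) (hα : 0 < Fintype.card α)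
    (hlt : 2 * Fintype.card α < Fintype.card ι)
    (hY : (Fintype.card ι : ℝ) * (Q * X + 1) ≤ Y)
    (he : (2 * Fintype.card α : ℝ) / ((Fintype.card ι : ℝ) - 2 * Fintype.card α) ≤ e) :
    ∃ p : ι → ℤ, p ≠ 0 ∧ (∀ i, |(p i : ℝ)| ≤ Y ^ e) ∧
      ∀ a, ‖∑ i, (p i : ℂ) * x a i‖ ≤ 2 * (Fintype.card ι : ℝ) * Y ^ e / Q := by
  let A : Matrix (α ⊕ α) ι ℤ := fun s i => s.elim (fun a => ⌊Q * (x a i).re⌋) (fun a => ⌊Q * (x a i).im⌋)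
  have hc : Fintype.card (α ⊕ α) = 2 * Fintype.card α := by rw [Fintype.card_sum]; ring
  obtain ⟨p, hp0, hAp, hp⟩ := Int.Matrix.exists_ne_zero_int_vec_norm_le A (by rw [hc]; exact hlt)
    (by rw [hc]; omega)
  have hfl : ∀ r : ℝ, |r| ≤ X → |((⌊Q * r⌋ : ℤ) : ℝ)| ≤ Q * X + 1 := by
    intro r hr
    rw [abs_le] at hr ⊢
    have h1 := Int.floor_le (Q * r)
    have h2 := Int.lt_floor_add_one (Q * r)
    constructor <;> nlinarith
  have hA : max 1 ‖A‖ ≤ Q * X + 1 := by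
    apply max_le
    · nlinarith
    · rw [Matrix.norm_le_iff (by nlinarith)]
      intro s i
      rw [Int.norm_eq_abs]
      rcases s with a | a
      · exact hfl _ ((Complex.abs_re_le_norm _).trans (hx a i))
      · exact hfl _ ((Complex.abs_im_le_norm _).trans (hx a i))
  have hι : (1 : ℝ) ≤ Fintype.card ι := by exact_mod_cast (by omega : 1 ≤ Fintype.card ι)
  have hY1 : 1 ≤ Y := by nlinarith [mul_nonneg (by linarith : (0:ℝ) ≤ Q) hX]
  have hlt' : (2 * Fintype.card α : ℝ) < Fintype.card ι := by exact_mod_cast hlt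
  have hpY : ‖p‖ ≤ Y ^ e := by
    refine hp.trans ?_
    rw [hc]; push_cast
    calc _ ≤ Y ^ ((2 * Fintype.card α : ℝ) / ((Fintype.card ι : ℝ) - 2 * Fintype.card α)) := by
          apply Real.rpow_le_rpow (by positivity)
          · refine le_trans ?_ hY
            gcongr
          · apply div_nonneg <;> [positivity; linarith]
      _ ≤ _ := Real.rpow_le_rpow_of_exponent_le hY1 he
  have hpi : ∀ i, |(p i : ℝ)| ≤ Y ^ e := fun i => by
    rw [← Int.norm_eq_abs]; exact (norm_le_pi_norm p i).trans hpY
  have hQ0 : 0 < Q := by linarith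
  have hYe : 0 ≤ Y ^ e := by positivity
  have hreal : ∀ y : ι → ℝ, (∑ i, ⌊Q * y i⌋ * p i = 0) → |∑ i, (p i : ℝ) * y i| ≤ Fintype.card ι * Y ^ e / Q := by
    intro y hy
    rw [le_div_iff₀ hQ0]
    have hab : |∑ i, (p i : ℝ) * y i| * Q = |∑ i, (p i : ℝ) * y i * Q| := by
      rw [← Finset.sum_mul, abs_mul, abs_of_pos hQ0]
    rw [hab]
    have hy' : ∑ i, (⌊Q * y i⌋ : ℝ) * p i = 0 := by exact_mod_cast hy
    have : ∑ i, (p i : ℝ) * y i * Q = ∑ i, (p i : ℝ) * (Q * y i - ⌊Q * y i⌋) := by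
      rw [← sub_zero (∑ i, (p i : ℝ) * y i * Q), ← hy', ← Finset.sum_sub_distrib]
      exact Finset.sum_congr rfl fun i _ => by ring
    rw [this]
    refine (Finset.abs_sum_le_sum_abs _ _).trans ?_
    rw [← nsmul_eq_mul, ← Finset.card_univ]
    apply Finset.sum_le_card_nsmul
    intro i _
    rw [abs_mul]
    have h1 := Int.floor_le (Q * y i)
    have h2 := Int.lt_floor_add_one (Q * y i)
    have : |Q * y i - ⌊Q * y i⌋| ≤ 1 := by rw [abs_le]; constructor <;> linarith
    calc _ ≤ Y ^ e * 1 := mul_le_mul (hpi i) this (abs_nonneg _) hYe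
      _ = _ := mul_one _
  refine ⟨p, hp0, hpi, fun a => ?_⟩
  refine (Complex.norm_le_abs_re_add_abs_im _).trans ?_
  have e1 : (∑ i, (p i : ℂ) * x a i).re = ∑ i, (p i : ℝ) * (x a i).re := by
    rw [Complex.re_sum]; exact Finset.sum_congr rfl fun i _ => by simp
  have e2 : (∑ i, (p i : ℂ) * x a i).im = ∑ i, (p i : ℝ) * (x a i).im := by
    rw [Complex.im_sum]; exact Finset.sum_congr rfl fun i _ => by simp
  rw [e1, e2]
  have h1 := hreal (fun i => (x a i).re) (congrFun hAp (Sum.inl a))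
  have h2 := hreal (fun i => (x a i).im) (congrFun hAp (Sum.inr a))
  calc _ ≤ _ := add_le_add h1 h2
    _ = _ := by ring

theorem vdm {β : Type} [Fintype β] (f v : β → ℂ) (hf : Function.Injective f)
    (h : ∀ l < Fintype.card β, ∑ b, v b * f b ^ l = 0) : v = 0 := by
  let e := Fintype.equivFin β
  have := Matrix.eq_zero_of_forall_pow_sum_mul_pow_eq_zero (f := f ∘ e.symm) (v := v ∘ e.symm)
    (hf.comp e.symm.injective) (fun i => by
      rw [← h i i.2]
      exact e.symm.sum_comp (fun b => v b * f b ^ (i : ℕ)))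
  funext b
  have := congrFun this (e b)
  simpa using this

section core
variable {L : ℕ}
def cA (k : ℕ) (a : Fin L × Fin L × Fin L) : ℤ := a.1 + k * a.2.1
def cB (h : ℤ) (a : Fin L × Fin L × Fin L) : ℤ := a.2.2 - h * a.2.1
noncomputable def av (g τ : ℂ) (k : ℕ) (h : ℤ) (p : Fin L × Fin L × Fin L → ℤ) (m1 m3 l : ℕ) : ℂ :=
  ∑ a, ((p a * cA k a ^ m1 * cB h a ^ m3 : ℤ) : ℂ) * g ^ ((a.1 : ℕ) * l) * τ ^ ((a.2.1 : ℕ) * l)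
noncomputable def cE (θ : ℝ) (k : ℕ) (h : ℤ) (a : Fin L × Fin L × Fin L) : ℂ :=
  cA k a * (θ * Complex.I) + cB h a * (2 * Real.pi * Complex.I)
noncomputable def fv (θ : ℝ) (k : ℕ) (h : ℤ) (p : Fin L × Fin L × Fin L → ℤ) (m1 m3 : ℕ) (z : ℂ) : ℂ :=
  ∑ a, ((p a * cA k a ^ m1 * cB h a ^ m3 : ℤ) : ℂ) * Complex.exp (cE θ k h a * z)

theorem core_final (g τ : ℂ) (k : ℕ) (h : ℤ) (p : Fin L × Fin L × Fin L → ℤ)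
    (hind : ∀ i j i' j' : ℕ, g ^ i * τ ^ j = g ^ i' * τ ^ j' → i = i' ∧ j = j')
    (hz : ∀ l < L * L, ∀ m3 < L, av g τ k h p 0 m3 l = 0) : p = 0 := by
  have h1 : ∀ m3 < L, (fun b : Fin L × Fin L => ∑ c : Fin L, (p (b.1, b.2, c) : ℂ) * (cB h (b.1, b.2, c) : ℂ) ^ m3) = 0 := by
    intro m3 hm3
    refine vdm (fun b : Fin L × Fin L => g ^ (b.1 : ℕ) * τ ^ (b.2 : ℕ)) _ ?_ ?_
    · intro b b' hb
      have := hind _ _ _ _ hb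
      exact Prod.ext (Fin.ext this.1) (Fin.ext this.2)
    · intro l hl
      rw [Fintype.card_prod, Fintype.card_fin] at hl
      rw [← hz l hl m3 hm3, av, Fintype.sum_prod_type, Fintype.sum_prod_type]
      refine Finset.sum_congr rfl fun i _ => ?_
      rw [Fintype.sum_prod_type]
      refine Finset.sum_congr rfl fun j _ => ?_
      rw [Finset.sum_mul]
      refine Finset.sum_congr rfl fun c _ => ?_
      push_cast
      rw [mul_pow, ← pow_mul, ← pow_mul]; ring
  funext a
  obtain ⟨i, j, c⟩ := a
  have h2 : (fun c : Fin L => (p (i, j, c) : ℂ)) = 0 := by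
    refine vdm (fun c => (cB h (i, j, c) : ℂ)) _ ?_ ?_
    · intro c c' hcc
      have : cB h (i, j, c) = cB h (i, j, c') := by
        simp only at hcc; exact_mod_cast hcc
      simp only [cB] at this
      apply Fin.ext; omega
    · intro l hl
      rw [Fintype.card_fin] at hl
      exact congrFun (h1 l hl) (i, j)
  have := congrFun h2 c
  simpa using this

theorem fv_diff (θ : ℝ) (k : ℕ) (h : ℤ) (p : Fin L × Fin L × Fin L → ℤ) (m1 m3 : ℕ) :
    Differentiable ℂ (fv θ k h p m1 m3) := by
  unfold fv; fun_prop

theorem fv_iter (θ : ℝ) (k : ℕ) (h : ℤ) (p : Fin L × Fin L × Fin L → ℤ) (m1 m3 t : ℕ) :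
    iteratedDeriv t (fv θ k h p m1 m3) = fun z =>
      ∑ a, ((p a * cA k a ^ m1 * cB h a ^ m3 : ℤ) : ℂ) * (cE θ k h a) ^ t * Complex.exp (cE θ k h a * z) := by
  induction t with
  | zero => funext z; simp [fv]
  | succ t ih =>
    rw [iteratedDeriv_succ, ih]
    funext z
    have : ∀ a : Fin L × Fin L × Fin L, HasDerivAt (fun z => ((p a * cA k a ^ m1 * cB h a ^ m3 : ℤ) : ℂ) * (cE θ k h a) ^ t * Complex.exp (cE θ k h a * z))
      (((p a * cA k a ^ m1 * cB h a ^ m3 : ℤ) : ℂ) * (cE θ k h a) ^ (t + 1) * Complex.exp (cE θ k h a * z)) z := by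
      intro a
      have h1 := (((hasDerivAt_id z).const_mul (cE θ k h a)).cexp).const_mul (((p a * cA k a ^ m1 * cB h a ^ m3 : ℤ) : ℂ) * (cE θ k h a) ^ t)
      refine HasDerivAt.congr_deriv h1 ?_
      simp only [id, mul_one]; ring
    exact (HasDerivAt.fun_sum fun a _ => this a).deriv

theorem fv_iter' (θ : ℝ) (k : ℕ) (h : ℤ) (p : Fin L × Fin L × Fin L → ℤ) (m1 m3 t : ℕ) (z : ℂ) :
    iteratedDeriv t (fv θ k h p m1 m3) z = ∑ i ∈ Finset.range (t + 1),
      (θ * Complex.I) ^ i * (2 * Real.pi * Complex.I) ^ (t - i) * (t.choose i) * fv θ k h p (m1 + i) (m3 + (t - i)) z := by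
  rw [fv_iter]
  simp only [fv, Finset.mul_sum]
  rw [Finset.sum_comm]
  refine Finset.sum_congr rfl fun a _ => ?_
  rw [cE, add_pow, Finset.mul_sum, Finset.sum_mul]
  refine Finset.sum_congr rfl fun i _ => ?_
  push_cast
  rw [mul_pow, mul_pow (cB h a : ℂ), pow_add, pow_add]; ring

theorem pow_sub_pow_le (x y : ℂ) (hx : ‖x‖ ≤ 2) (hy : ‖y‖ ≤ 2) (m : ℕ) :
    ‖x ^ m - y ^ m‖ ≤ m * 2 ^ m * ‖x - y‖ := by
  induction m with
  | zero => simp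
  | succ m ih =>
    have : x ^ (m + 1) - y ^ (m + 1) = x * (x ^ m - y ^ m) + (x - y) * y ^ m := by ring
    rw [this]
    refine (norm_add_le _ _).trans ?_
    rw [norm_mul, norm_mul, norm_pow]
    have h1 : ‖y‖ ^ m ≤ 2 ^ m := by gcongr
    have h0 := norm_nonneg (x - y)
    calc _ ≤ 2 * (m * 2 ^ m * ‖x - y‖) + ‖x - y‖ * 2 ^ m := by gcongr
      _ ≤ _ := by push_cast; rw [pow_succ]; nlinarith [pow_pos (show (0:ℝ) < 2 by norm_num) m, mul_nonneg h0 (pow_pos (show (0:ℝ) < 2 by norm_num) m).le]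

theorem cE_exp (θ : ℝ) (k : ℕ) (h : ℤ) (a : Fin L × Fin L × Fin L) (g : ℂ) (hg : Complex.exp (θ * Complex.I) = g) (l : ℕ) :
    Complex.exp (cE θ k h a * l) = g ^ ((a.1 : ℕ) * l) * (g ^ k) ^ ((a.2.1 : ℕ) * l) := by
  rw [← hg, ← Complex.exp_nat_mul, ← Complex.exp_nat_mul, ← Complex.exp_nat_mul, ← Complex.exp_add]
  rw [Complex.exp_eq_exp_iff_exists_int]
  refine ⟨cB h a * l, ?_⟩
  simp only [cE, cA]
  push_cast
  ring

theorem fv_av (θ : ℝ) (k : ℕ) (h : ℤ) (g τ : ℂ) (hg : Complex.exp (θ * Complex.I) = g) (hτ : ‖τ‖ ≤ 2)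
    (p : Fin L × Fin L × Fin L → ℤ) (m1 m3 l D : ℕ) (W : ℝ) (hD : L * l ≤ D)
    (hW : ∑ a, |((p a * cA k a ^ m1 * cB h a ^ m3 : ℤ) : ℝ)| ≤ W) :
    ‖fv θ k h p m1 m3 l - av g τ k h p m1 m3 l‖ ≤ W * (D * 2 ^ D * ‖g ^ k - τ‖) := by
  have hg1 : ‖g‖ = 1 := by rw [← hg]; exact Complex.norm_exp_ofReal_mul_I θ
  rw [fv, av, ← Finset.sum_sub_distrib]
  refine (norm_sum_le _ _).trans (le_trans ?_ (mul_le_mul_of_nonneg_right hW (by positivity)))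
  rw [Finset.sum_mul]
  refine Finset.sum_le_sum fun a _ => ?_
  rw [cE_exp θ k h a g hg l, ← mul_assoc, ← mul_sub, norm_mul, norm_mul, Complex.norm_intCast, norm_pow, hg1, one_pow, mul_one]
  refine mul_le_mul_of_nonneg_left ?_ (abs_nonneg _)
  refine (pow_sub_pow_le _ _ (by rw [norm_pow, hg1, one_pow]; norm_num) hτ _).trans ?_
  have : (a.2.1 : ℕ) * l ≤ D := le_trans (Nat.mul_le_mul_right _ a.2.1.2.le) hD
  gcongr
  norm_num

theorem fv_bound (θ : ℝ) (k : ℕ) (h : ℤ) (hθ : |θ| ≤ 4) (hh : |k * θ - 2 * Real.pi * h| ≤ 4)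
    (p : Fin L × Fin L × Fin L → ℤ) (m1 m3 : ℕ) (W R : ℝ)
    (hW : ∑ a, |((p a * cA k a ^ m1 * cB h a ^ m3 : ℤ) : ℝ)| ≤ W) (z : ℂ) (hz : ‖z‖ ≤ R) :
    ‖fv θ k h p m1 m3 z‖ ≤ W * Real.exp (20 * L * R) := by
  rw [fv]
  refine (norm_sum_le _ _).trans (le_trans ?_ (mul_le_mul_of_nonneg_right hW (by positivity)))
  rw [Finset.sum_mul]
  refine Finset.sum_le_sum fun a _ => ?_
  rw [norm_mul, Complex.norm_intCast]
  refine mul_le_mul_of_nonneg_left ?_ (abs_nonneg _)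
  refine (Complex.norm_exp_le_exp_norm _).trans (Real.exp_le_exp.2 ?_)
  rw [norm_mul]
  have hE : ‖cE θ k h a‖ ≤ 20 * L := by
    have : cE θ k h a = (((a.1 : ℕ) * θ + (a.2.1 : ℕ) * (k * θ - 2 * Real.pi * h) + (a.2.2 : ℕ) * (2 * Real.pi) : ℝ) : ℂ) * Complex.I := by
      simp only [cE, cA, cB]; push_cast; ring
    rw [this, norm_mul, Complex.norm_I, mul_one, Complex.norm_real, Real.norm_eq_abs]
    have h1 : ((a.1 : ℕ) : ℝ) ≤ L := by exact_mod_cast a.1.2.le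
    have h2 : ((a.2.1 : ℕ) : ℝ) ≤ L := by exact_mod_cast a.2.1.2.le
    have h3 : ((a.2.2 : ℕ) : ℝ) ≤ L := by exact_mod_cast a.2.2.2.le
    have hp := Real.pi_lt_d2
    have hp0 := Real.pi_pos
    refine (abs_add_le _ _).trans ?_
    have q1 := abs_add_le ((a.1 : ℕ) * θ) ((a.2.1 : ℕ) * (k * θ - 2 * Real.pi * h))
    rw [abs_mul, abs_mul, Nat.abs_cast, Nat.abs_cast] at q1
    rw [abs_mul, Nat.abs_cast, abs_of_pos (by linarith : 0 < 2 * Real.pi)]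
    have r1 : ((a.1 : ℕ) : ℝ) * |θ| ≤ L * 4 := by gcongr
    have r2 : ((a.2.1 : ℕ) : ℝ) * |k * θ - 2 * Real.pi * h| ≤ L * 4 := by gcongr
    have r3 : ((a.2.2 : ℕ) : ℝ) * (2 * Real.pi) ≤ L * 7 := by gcongr; linarith
    have : (0 : ℝ) ≤ L := by positivity
    linarith
  exact mul_le_mul hE hz (norm_nonneg _) (by positivity)

theorem core_step (θ : ℝ) (k : ℕ) (h : ℤ) (g τ : ℂ) (hg : Complex.exp (θ * Complex.I) = g) (hτ : ‖τ‖ ≤ 2)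
    (hθ : |θ| ≤ 4) (hh : |k * θ - 2 * Real.pi * h| ≤ 4)
    (p : Fin L × Fin L × Fin L → ℤ) (S S' M M' : ℕ) (hSS : S ≤ S') (W Λ δ : ℝ) (hS' : 0 < S')
    (hW : ∀ m1 m3, m1 + m3 < M + M' → ∑ a, |((p a * cA k a ^ m1 * cB h a ^ m3 : ℤ) : ℝ)| ≤ W)
    (hδ : ‖g ^ k - τ‖ ≤ δ)
    (hL : ∀ m1 m3 l, m1 + m3 < M → l < S' → av g τ k h p m1 m3 l ≠ 0 → 1 ≤ ‖av g τ k h p m1 m3 l‖ * Λ)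
    (hΛ : 0 ≤ Λ) (hW0 : 0 ≤ W)
    (hnum : (W * Real.exp (20 * L * (7 * S')) * (1 / 3) ^ (S * M') +
      11 ^ M' * (W * ((L * S' : ℕ) * 2 ^ (L * S') * δ)) * ((M' + 3) * S') ^ (S * M') +
      W * ((L * S' : ℕ) * 2 ^ (L * S') * δ)) * Λ < 1)
    (hz : ∀ l < S, ∀ m1 m3, m1 + m3 < M + M' → av g τ k h p m1 m3 l = 0) :
    ∀ l < S', ∀ m1 m3, m1 + m3 < M → av g τ k h p m1 m3 l = 0 := by
  intro l hl m1 m3 hm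
  by_contra hne
  have h1 := hL m1 m3 l hm hl hne
  have hδ0 : 0 ≤ δ := (norm_nonneg _).trans hδ
  set ε0 := W * ((L * S' : ℕ) * 2 ^ (L * S') * δ) with hε0
  have hε0' : 0 ≤ ε0 := by positivity
  have hfa : ∀ l < S', ∀ m1 m3, m1 + m3 < M + M' → ‖fv θ k h p m1 m3 l - av g τ k h p m1 m3 l‖ ≤ ε0 := by
    intro l hl m1 m3 hm
    refine (fv_av θ k h g τ hg hτ p m1 m3 l (L * S') W (Nat.mul_le_mul_left _ hl.le) (hW m1 m3 hm)).trans ?_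
    rw [hε0]; gcongr
  have hder : ∀ c < S, ∀ t < M', ‖iteratedDeriv t (fv θ k h p m1 m3) (c : ℂ)‖ ≤ (11 ^ M' * ε0) * t.factorial := by
    intro c hc t ht
    have hb : ‖iteratedDeriv t (fv θ k h p m1 m3) (c : ℂ)‖ ≤ 11 ^ t * ε0 := by
      rw [fv_iter']
      refine (norm_sum_le _ _).trans ?_
      have e11 : (11 : ℝ) ^ t = ∑ i ∈ Finset.range (t + 1), (4 : ℝ) ^ i * 7 ^ (t - i) * (t.choose i) := by
        rw [← add_pow]; norm_num
      rw [e11, Finset.sum_mul]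
      refine Finset.sum_le_sum fun i hi => ?_
      have hi' : i ≤ t := by have := Finset.mem_range.1 hi; omega
      rw [norm_mul, norm_mul, norm_mul, norm_pow, norm_pow, Complex.norm_natCast]
      have n1 : ‖(θ : ℂ) * Complex.I‖ ≤ 4 := by
        rw [norm_mul, Complex.norm_I, mul_one, Complex.norm_real]; exact hθ
      have n2 : ‖(2 : ℂ) * Real.pi * Complex.I‖ ≤ 7 := by
        rw [norm_mul, Complex.norm_I, mul_one, norm_mul, Complex.norm_real, Real.norm_eq_abs, abs_of_pos Real.pi_pos]
        have := Real.pi_lt_d2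
        norm_num; linarith
      have n3 : ‖fv θ k h p (m1 + i) (m3 + (t - i)) c‖ ≤ ε0 := by
        have := hfa c (by omega) (m1 + i) (m3 + (t - i)) (by omega)
        rwa [hz c hc (m1 + i) (m3 + (t - i)) (by omega), sub_zero] at this
      gcongr
    refine hb.trans ?_
    have e1 : (1 : ℝ) ≤ t.factorial := by exact_mod_cast Nat.succ_le_of_lt (Nat.factorial_pos t)
    have e2 : (11 : ℝ) ^ t ≤ 11 ^ M' := pow_le_pow_right₀ (by norm_num) ht.le
    calc _ ≤ 11 ^ M' * ε0 := by gcongr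
      _ ≤ _ := le_mul_of_one_le_right (by positivity) e1
  have hS'r : (1 : ℝ) ≤ S' := by exact_mod_cast hS'
  have hSSr : (S : ℝ) ≤ S' := by exact_mod_cast hSS
  have hlr : (l : ℝ) < S' := by exact_mod_cast hl
  have hsch := schwarz_approx S M' (7 * S') S' (l : ℂ) (by linarith) (by rw [Complex.norm_natCast]; linarith)
    hS'r (by
      intro c hc
      have : ((l : ℂ) - c) = (((l : ℝ) - c : ℝ) : ℂ) := by push_cast; rfl
      rw [this, Complex.norm_real, Real.norm_eq_abs, abs_le]
      have hcr : (c : ℝ) < S := by exact_mod_cast hc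
      have : (0 : ℝ) ≤ c := by positivity
      have : (0 : ℝ) ≤ l := by positivity
      constructor <;> linarith)
    (S * M') (fun _ => M') (fv θ k h p m1 m3) (W * Real.exp (20 * L * (7 * S'))) (11 ^ M' * ε0)
    (fv_diff _ _ _ _ _ _) (fun _ => le_rfl) (by simp) hder
    (fun x hx => fv_bound θ k h hθ hh p m1 m3 W _ (hW m1 m3 (by omega)) x hx) (by positivity)
  have hq : (2 * (S' : ℝ) / (7 * S' - S)) ^ (S * M') ≤ (1 / 3) ^ (S * M') := by
    have hpos : 0 < 7 * (S' : ℝ) - S := by linarith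
    apply pow_le_pow_left₀
    · apply div_nonneg <;> linarith
    · rw [div_le_iff₀ hpos]; linarith
  have hav : ‖av g τ k h p m1 m3 l‖ ≤ ‖fv θ k h p m1 m3 l‖ + ε0 := by
    have := hfa l hl m1 m3 (by omega)
    have h2 := norm_sub_norm_le (av g τ k h p m1 m3 l) (fv θ k h p m1 m3 l)
    rw [norm_sub_rev] at h2
    linarith
  have : ‖av g τ k h p m1 m3 l‖ ≤ W * Real.exp (20 * L * (7 * S')) * (1 / 3) ^ (S * M') +
      11 ^ M' * ε0 * ((M' + 3) * S') ^ (S * M') + ε0 := by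
    have h5 : W * Real.exp (20 * L * (7 * S')) * (2 * (S' : ℝ) / (7 * S' - S)) ^ (S * M') ≤ W * Real.exp (20 * L * (7 * S')) * (1 / 3) ^ (S * M') := by
      gcongr
    linarith
  have := mul_le_mul_of_nonneg_right this hΛ
  linarith
end core

theorem exp_neg_small {y : ℝ} (hy : 3 ≤ y) : Real.exp (-y) ≤ 1 / 4 := by
  have h := Real.add_one_le_exp y
  rw [Real.exp_neg, inv_eq_one_div]
  apply one_div_le_one_div_of_le <;> linarith

theorem step_num (n Z W E1 q c d δ b Λ N : ℝ) (hW : W ≤ Real.exp (213 * Z)) (hE : E1 ≤ Real.exp (140 * Z))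
    (hq : q ≤ Real.exp (-(n * Z))) (hc : c ≤ Real.exp (3 * Z)) (hd : d ≤ Real.exp (2 * Z))
    (hδ : δ ≤ Real.exp (-N)) (hb : b ≤ Real.exp (n ^ 2 * Z)) (hΛ : Λ ≤ Real.exp (3888 * Z))
    (hn : 10000 ≤ n) (hZ : 1 ≤ Z) (hN : n * (n ^ 2 * Z) ≤ N)
    (w0 : 0 ≤ W) (e0 : 0 ≤ E1) (q0 : 0 ≤ q) (c0 : 0 ≤ c) (d0 : 0 ≤ d) (δ0 : 0 ≤ δ) (b0 : 0 ≤ b) (l0 : 0 ≤ Λ) :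
    (W * E1 * q + c * (W * (d * δ)) * b + W * (d * δ)) * Λ < 1 := by
  have hZn : 10000 ≤ n ^ 2 * Z := by nlinarith
  have t1 : W * E1 * q * Λ ≤ 1 / 4 := by
    calc _ ≤ Real.exp (213 * Z) * Real.exp (140 * Z) * Real.exp (-(n * Z)) * Real.exp (3888 * Z) := by gcongr
      _ = Real.exp (-(n * Z - 4241 * Z)) := by rw [← Real.exp_add, ← Real.exp_add, ← Real.exp_add]; ring_nf
      _ ≤ _ := exp_neg_small (by nlinarith)
  have hbig : 2 * (n ^ 2 * Z) ≤ N := by nlinarith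
  have h2 : 4107 * Z ≤ n ^ 2 * Z := mul_le_mul_of_nonneg_right (by nlinarith) (by linarith)
  have t2 : c * (W * (d * δ)) * b * Λ ≤ 1 / 4 := by
    calc _ ≤ Real.exp (3 * Z) * (Real.exp (213 * Z) * (Real.exp (2 * Z) * Real.exp (-N))) * Real.exp (n ^ 2 * Z) * Real.exp (3888 * Z) := by gcongr
      _ = Real.exp (-(N - n ^ 2 * Z - 4106 * Z)) := by
        rw [← Real.exp_add, ← Real.exp_add, ← Real.exp_add, ← Real.exp_add, ← Real.exp_add]; ring_nf
      _ ≤ _ := exp_neg_small (by nlinarith)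
  have t3 : W * (d * δ) * Λ ≤ 1 / 4 := by
    calc _ ≤ Real.exp (213 * Z) * (Real.exp (2 * Z) * Real.exp (-N)) * Real.exp (3888 * Z) := by gcongr
      _ = Real.exp (-(N - 4103 * Z)) := by
        rw [← Real.exp_add, ← Real.exp_add, ← Real.exp_add]; ring_nf
      _ ≤ _ := exp_neg_small (by nlinarith)
  linarith [add_mul (W * E1 * q + c * (W * (d * δ)) * b) (W * (d * δ)) Λ, add_mul (W * E1 * q) (c * (W * (d * δ)) * b) Λ]

theorem two_pow_le_exp (m : ℕ) : (2 : ℝ) ^ m ≤ Real.exp m := by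
  rw [← mul_one (m : ℝ), Real.exp_nat_mul]
  gcongr
  linarith [Real.exp_one_gt_d9]

theorem eleven_pow_le_exp (m : ℕ) : (11 : ℝ) ^ m ≤ Real.exp (3 * m) := by
  rw [mul_comm, Real.exp_nat_mul]
  gcongr
  have : Real.exp 3 = Real.exp 1 ^ 3 := by rw [← Real.exp_nat_mul]; norm_num
  rw [this]
  calc (11 : ℝ) ≤ 2.7 ^ 3 := by norm_num
    _ ≤ _ := by gcongr; linarith [Real.exp_one_gt_d9]

theorem third_pow_le_exp (m : ℕ) : ((1 : ℝ) / 3) ^ m ≤ Real.exp (-m) := by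
  rw [← mul_neg_one (m : ℝ), Real.exp_nat_mul]
  gcongr
  rw [Real.exp_neg, inv_eq_one_div]
  apply one_div_le_one_div_of_le (Real.exp_pos _)
  linarith [Real.exp_one_lt_d9]

set_option maxHeartbeats 4000000 in
theorem core_contra (n : ℕ) (hn : 10000 ≤ n) (hbig : (n : ℝ) ^ 200 ≤ Real.exp n) (P : Polynomial ℤ)
    (hP : ∀ ρ : ℂ, ρ ^ 3 = ρ ^ 2 + ρ + 1 → ‖Polynomial.aeval ρ P‖ ≤ Real.exp n) (χ : ℂ)
    (hχ : χ ^ 2 - Polynomial.aeval (al : ℂ) P * χ + 1 = 0) (k : ℕ) (hk1 : 1 ≤ k) (hk : (k : ℝ) ≤ Real.exp n)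
    (hδ : ‖((al : ℂ) * be ^ 2) ^ k - χ * (qD be * qE ga) / 44‖ ≤ Real.exp (-(n : ℝ) ^ 119)) : False := by
  have hind := indep P χ hχ
  have hliou := fun (s : Finset (Fin (n ^ 37) × Fin (n ^ 37) × Fin (n ^ 37))) => liouville n (by exact_mod_cast (by omega : 10 ≤ n)) P hP χ hχ s
  have hg1 : ‖(al : ℂ) * be ^ 2‖ = 1 := by
    rw [g_eq, norm_div, norm_be_ga, div_self]; exact norm_ne_zero_iff.2 ga_ne
  generalize (al : ℂ) * be ^ 2 = g at *
  generalize χ * (qD be * qE ga) / 44 = τ at *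
  have nR : (10000 : ℝ) ≤ n := by exact_mod_cast hn
  have n1 : (1 : ℝ) ≤ n := by linarith
  have npow : ∀ i j : ℕ, i ≤ j → (n : ℝ) ^ i ≤ (n : ℝ) ^ j := fun i j h => pow_le_pow_right₀ n1 h
  have nn : ∀ i j : ℕ, i ≤ j → n ^ i ≤ n ^ j := fun i j h => Nat.pow_le_pow_right (by omega) h
  obtain ⟨θ, hθ, hg⟩ : ∃ θ : ℝ, |θ| ≤ Real.pi ∧ Complex.exp (θ * Complex.I) = g := by
    refine ⟨Complex.arg g, Complex.abs_arg_le_pi g, ?_⟩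
    have := Complex.norm_mul_exp_arg_mul_I g
    rwa [hg1, Complex.ofReal_one, one_mul] at this
  have hpi := Real.pi_pos
  have hpi2 := Real.pi_lt_d2
  have hpi3 := Real.pi_gt_d2
  obtain ⟨h, hh⟩ : ∃ h : ℤ, |k * θ - 2 * Real.pi * h| ≤ Real.pi := by
    refine ⟨round (k * θ / (2 * Real.pi)), ?_⟩
    have h1 := abs_sub_round (k * θ / (2 * Real.pi))
    have : k * θ - 2 * Real.pi * round (k * θ / (2 * Real.pi)) =
      2 * Real.pi * (k * θ / (2 * Real.pi) - round (k * θ / (2 * Real.pi))) := by field_simp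
    rw [this, abs_mul, abs_of_pos (by linarith)]
    nlinarith
  have hk1r : (1 : ℝ) ≤ k := by exact_mod_cast hk1
  have hhk : |(h : ℝ)| ≤ k := by
    have h1 : |2 * Real.pi * (h : ℝ)| ≤ 2 * Real.pi * k := by
      have e : 2 * Real.pi * (h : ℝ) = k * θ - (k * θ - 2 * Real.pi * h) := by ring
      rw [e]
      refine (abs_sub _ _).trans ?_
      rw [abs_mul, Nat.abs_cast]
      nlinarith
    rw [abs_mul, abs_of_pos (by linarith : 0 < 2 * Real.pi)] at h1
    exact le_of_mul_le_mul_left h1 (by linarith)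
  have hδ1 : Real.exp (-(n : ℝ) ^ 119) ≤ 1 := by
    rw [Real.exp_le_one_iff]; have : (0 : ℝ) ≤ (n : ℝ) ^ 119 := by positivity
    linarith
  have hτ : ‖τ‖ ≤ 2 := by
    have h1 := norm_sub_norm_le τ (g ^ k)
    rw [norm_sub_rev, norm_pow, hg1, one_pow] at h1
    linarith
  have hLr : ((n ^ 37 : ℕ) : ℝ) = (n : ℝ) ^ 37 := by push_cast; rfl
  have habs : 2 * (n : ℝ) ^ 37 * k ≤ Real.exp (2 * n) := by
    have : Real.exp (2 * n) = Real.exp n * Real.exp n := by rw [← Real.exp_add]; ring_nf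
    rw [this]
    have : 2 * (n : ℝ) ^ 37 ≤ Real.exp n := by
      calc 2 * (n : ℝ) ^ 37 ≤ n * (n : ℝ) ^ 37 := by gcongr; linarith
        _ = (n : ℝ) ^ 38 := by ring
        _ ≤ _ := (npow _ _ (by norm_num)).trans hbig
    gcongr
  have hA : ∀ a : Fin (n ^ 37) × Fin (n ^ 37) × Fin (n ^ 37), |((cA k a : ℤ) : ℝ)| ≤ Real.exp (2 * n) := by
    intro a
    refine le_trans ?_ habs
    have h1 : ((a.1 : ℕ) : ℝ) ≤ (n : ℝ) ^ 37 := by rw [← hLr]; exact_mod_cast a.1.2.le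
    have h2 : ((a.2.1 : ℕ) : ℝ) ≤ (n : ℝ) ^ 37 := by rw [← hLr]; exact_mod_cast a.2.1.2.le
    have : ((cA k a : ℤ) : ℝ) = (a.1 : ℕ) + k * (a.2.1 : ℕ) := by simp [cA]
    rw [this, abs_of_nonneg (by positivity)]
    have h3 : (0 : ℝ) ≤ (n : ℝ) ^ 37 := by positivity
    nlinarith
  have hB : ∀ a : Fin (n ^ 37) × Fin (n ^ 37) × Fin (n ^ 37), |((cB h a : ℤ) : ℝ)| ≤ Real.exp (2 * n) := by
    intro a
    refine le_trans ?_ habs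
    have h1 : ((a.2.2 : ℕ) : ℝ) ≤ (n : ℝ) ^ 37 := by rw [← hLr]; exact_mod_cast a.2.2.2.le
    have h2 : ((a.2.1 : ℕ) : ℝ) ≤ (n : ℝ) ^ 37 := by rw [← hLr]; exact_mod_cast a.2.1.2.le
    have : ((cB h a : ℤ) : ℝ) = (a.2.2 : ℕ) - h * (a.2.1 : ℕ) := by simp [cB]
    rw [this]
    refine (abs_sub _ _).trans ?_
    rw [abs_mul, Nat.abs_cast, Nat.abs_cast]
    have h3 : (0 : ℝ) ≤ (n : ℝ) ^ 37 := by positivity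
    have h4 : |(h : ℝ)| * (a.2.1 : ℕ) ≤ k * (n : ℝ) ^ 37 := by gcongr
    nlinarith
  have hAB : ∀ (a : Fin (n ^ 37) × Fin (n ^ 37) × Fin (n ^ 37)) (m1 m3 : ℕ),
      |((cA k a ^ m1 * cB h a ^ m3 : ℤ) : ℝ)| ≤ Real.exp (2 * n * (m1 + m3)) := by
    intro a m1 m3
    push_cast
    rw [abs_mul, abs_pow, abs_pow, mul_add, Real.exp_add, mul_comm (2 * (n : ℝ)) m1, mul_comm (2 * (n : ℝ)) m3,
      Real.exp_nat_mul, Real.exp_nat_mul]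
    gcongr
    · exact hA a
    · exact hB a
  -- powers of n
  have hcardι : Fintype.card (Fin (n ^ 37) × Fin (n ^ 37) × Fin (n ^ 37)) = n ^ 111 := by
    simp only [Fintype.card_prod, Fintype.card_fin]; ring
  have hcardα : Fintype.card (Fin (n ^ 2) × Fin (6 * n ^ 54) × Fin (6 * n ^ 54)) = 36 * n ^ 110 := by
    simp only [Fintype.card_prod, Fintype.card_fin]; ring
  have hn110 : 0 < n ^ 110 := by positivity
  have p1 : (n : ℝ) ^ 39 ≤ (n : ℝ) ^ 55 := npow _ _ (by norm_num)
  have p0 : (n : ℝ) ≤ (n : ℝ) ^ 39 := by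
    calc (n : ℝ) = (n : ℝ) ^ 1 := (pow_one _).symm
      _ ≤ _ := npow _ _ (by norm_num)
  have p2 : (n : ℝ) ^ 56 = n * (n : ℝ) ^ 55 := by ring
  have p55 : (1 : ℝ) ≤ (n : ℝ) ^ 55 := one_le_pow₀ n1
  have hN111 : (n : ℝ) ^ 111 ≤ Real.exp n := (npow _ _ (by norm_num)).trans hbig
  have hexp2 : (2 : ℝ) ≤ Real.exp n := by linarith [Real.add_one_le_exp (n : ℝ)]
  set K : ℝ := (n : ℝ) ^ 55 with hK
  obtain ⟨p, hp0, hpb, hpsmall⟩ := siegelC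
    (fun (r : Fin (n ^ 2) × Fin (6 * n ^ 54) × Fin (6 * n ^ 54)) (a : Fin (n ^ 37) × Fin (n ^ 37) × Fin (n ^ 37)) =>
      ((cA k a ^ (r.2.1 : ℕ) * cB h a ^ (r.2.2 : ℕ) : ℤ) : ℂ) * g ^ ((a.1 : ℕ) * (r.1 : ℕ)) * τ ^ ((a.2.1 : ℕ) * (r.1 : ℕ)))
    (Real.exp (25 * K)) (Real.exp ((n : ℝ) ^ 56)) (Real.exp (2 * (n : ℝ) ^ 56)) (100 / n)
    (by
      intro r a
      rw [norm_mul, norm_mul, Complex.norm_intCast, norm_pow, hg1, one_pow, mul_one, norm_pow]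
      have h1 := hAB a r.2.1 r.2.2
      have h2 : ((r.2.1 : ℕ) : ℝ) ≤ 6 * (n : ℝ) ^ 54 := by
        have := r.2.1.2.le
        exact_mod_cast this
      have h3 : ((r.2.2 : ℕ) : ℝ) ≤ 6 * (n : ℝ) ^ 54 := by
        have := r.2.2.2.le
        exact_mod_cast this
      have h4 : ‖τ‖ ^ ((a.2.1 : ℕ) * (r.1 : ℕ)) ≤ Real.exp ((n : ℝ) ^ 39) := by
        calc _ ≤ (2 : ℝ) ^ ((a.2.1 : ℕ) * (r.1 : ℕ)) := by gcongr
          _ ≤ 2 ^ (n ^ 39) := by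
            apply pow_le_pow_right₀ (by norm_num)
            calc _ ≤ n ^ 37 * n ^ 2 := Nat.mul_le_mul a.2.1.2.le r.1.2.le
              _ = n ^ 39 := by ring
          _ ≤ _ := by have := two_pow_le_exp (n ^ 39); push_cast at this; exact this
      calc _ ≤ Real.exp (2 * n * (((r.2.1 : ℕ) : ℝ) + (r.2.2 : ℕ))) * Real.exp ((n : ℝ) ^ 39) := by gcongr
        _ ≤ Real.exp (2 * n * (6 * (n : ℝ) ^ 54 + 6 * (n : ℝ) ^ 54)) * Real.exp ((n : ℝ) ^ 39) := by gcongr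
        _ = Real.exp (24 * K + (n : ℝ) ^ 39) := by rw [← Real.exp_add, hK]; ring_nf
        _ ≤ _ := by gcongr; linarith)
    (Real.one_le_exp (by positivity)) (Real.exp_pos _).le (by rw [hcardα]; omega)
    (by
      rw [hcardα, hcardι]
      calc 2 * (36 * n ^ 110) < n * n ^ 110 := by nlinarith
        _ = n ^ 111 := by ring)
    (by
      rw [hcardι]
      push_cast
      rw [← Real.exp_add]
      have h1 : (1 : ℝ) ≤ Real.exp ((n : ℝ) ^ 56 + 25 * K) := Real.one_le_exp (by positivity)
      calc _ ≤ Real.exp n * (2 * Real.exp ((n : ℝ) ^ 56 + 25 * K)) := by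
            apply mul_le_mul hN111 _ (by positivity) (by positivity); linarith
        _ ≤ Real.exp n * (Real.exp n * Real.exp ((n : ℝ) ^ 56 + 25 * K)) := by gcongr
        _ = Real.exp (n + n + ((n : ℝ) ^ 56 + 25 * K)) := by
          rw [← Real.exp_add, ← Real.exp_add]; ring_nf
        _ ≤ _ := by
          apply Real.exp_le_exp.2
          rw [p2]; nlinarith)
    (by
      rw [hcardα, hcardι]
      push_cast
      have e : 2 * (36 * (n : ℝ) ^ 110) / ((n : ℝ) ^ 111 - 2 * (36 * (n : ℝ) ^ 110)) = 72 / (n - 72) := by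
        have : (n : ℝ) ^ 111 - 2 * (36 * (n : ℝ) ^ 110) = (n : ℝ) ^ 110 * (n - 72) := by ring
        rw [this]
        have : (n : ℝ) - 72 ≠ 0 := by linarith
        have : (n : ℝ) ≠ 0 := by linarith
        field_simp
        norm_num
      rw [e, div_le_div_iff₀ (by linarith) (by linarith)]
      linarith)
  have hYe : Real.exp (2 * (n : ℝ) ^ 56) ^ (100 / (n : ℝ)) = Real.exp (200 * K) := by
    rw [← Real.exp_mul]
    congr 1
    rw [p2]
    field_simp
    norm_num
  rw [hYe] at hpb hpsmall
  rw [hcardι] at hpsmall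
  set W := Real.exp (213 * K) with hWdef
  have hW : ∀ m1 m3, m1 + m3 < 6 * n ^ 54 → ∑ a, |((p a * cA k a ^ m1 * cB h a ^ m3 : ℤ) : ℝ)| ≤ W := by
    intro m1 m3 hm
    have hm' : (m1 : ℝ) + m3 ≤ 6 * (n : ℝ) ^ 54 := by exact_mod_cast hm.le
    have : ∀ a, |((p a * cA k a ^ m1 * cB h a ^ m3 : ℤ) : ℝ)| ≤ Real.exp (212 * K) := by
      intro a
      rw [mul_assoc, Int.cast_mul, abs_mul]
      calc _ ≤ Real.exp (200 * K) * Real.exp (2 * n * (m1 + m3)) := mul_le_mul (hpb a) (hAB a m1 m3) (abs_nonneg _) (Real.exp_pos _).le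
        _ ≤ Real.exp (200 * K) * Real.exp (2 * n * (6 * (n : ℝ) ^ 54)) := by gcongr
        _ = _ := by rw [← Real.exp_add, hK]; ring_nf
    calc _ ≤ ∑ a : Fin (n ^ 37) × Fin (n ^ 37) × Fin (n ^ 37), Real.exp (212 * K) := Finset.sum_le_sum fun a _ => this a
      _ = (n : ℝ) ^ 111 * Real.exp (212 * K) := by
        rw [Finset.sum_const, Finset.card_univ, hcardι, nsmul_eq_mul]; push_cast; rfl
      _ ≤ Real.exp n * Real.exp (212 * K) := by gcongr
      _ = Real.exp (n + 212 * K) := by rw [Real.exp_add]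
      _ ≤ _ := by apply Real.exp_le_exp.2; linarith
  have hW1 : 1 ≤ W := Real.one_le_exp (by positivity)
  -- Liouville for av
  have hL : ∀ S' m1 m3 l : ℕ, m1 + m3 < 6 * n ^ 54 → l < S' → av g τ k h p m1 m3 l ≠ 0 →
      1 ≤ ‖av g τ k h p m1 m3 l‖ * (W * Real.exp (3 * n * ((n ^ 37 * S' : ℕ) : ℝ))) ^ 18 := by
    intro S' m1 m3 l hm hl hne
    exact hliou Finset.univ (fun a => p a * cA k a ^ m1 * cB h a ^ m3) (fun a => (a.1 : ℕ) * l)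
      (fun a => (a.2.1 : ℕ) * l) (n ^ 37 * S') (fun a _ => Nat.mul_le_mul a.1.2.le hl.le)
      (fun a _ => Nat.mul_le_mul a.2.1.2.le hl.le) W hW1 (hW m1 m3 hm) hne
  have main : ∀ i : ℕ, i ≤ 5 → ∀ l < n ^ (2 + 15 * i), ∀ m1 m3, m1 + m3 < (6 - i) * n ^ 54 → av g τ k h p m1 m3 l = 0 := by
    intro i
    induction i with
    | zero =>
      intro _ l hl m1 m3 hm
      simp only [mul_zero, add_zero, Nat.sub_zero] at hl hm
      by_contra hne
      have h1 := hL (n ^ 2) m1 m3 l hm hl hne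
      have h2 := hpsmall (⟨l, hl⟩, ⟨m1, by omega⟩, ⟨m3, by omega⟩)
      have h3 : ‖av g τ k h p m1 m3 l‖ ≤ 2 * ((n ^ 111 : ℕ) : ℝ) * Real.exp (200 * K) / Real.exp ((n : ℝ) ^ 56) := by
        refine le_trans (le_of_eq ?_) h2
        rw [av]
        congr 1
        refine Finset.sum_congr rfl fun a _ => ?_
        push_cast; ring
      have h4 : (W * Real.exp (3 * n * ((n ^ 37 * n ^ 2 : ℕ) : ℝ))) ^ 18 ≤ Real.exp (3888 * K) := by
        rw [hWdef, ← Real.exp_add, ← Real.exp_nat_mul]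
        apply Real.exp_le_exp.2
        push_cast
        have : (n : ℝ) * ((n : ℝ) ^ 37 * (n : ℝ) ^ 2) ≤ K := by
          have := npow 40 55 (by norm_num)
          rw [hK]; calc _ = (n : ℝ) ^ 40 := by ring
            _ ≤ _ := this
        nlinarith
      have h5 : 2 * ((n ^ 111 : ℕ) : ℝ) * Real.exp (200 * K) / Real.exp ((n : ℝ) ^ 56) ≤ Real.exp (n + n + 200 * K - (n : ℝ) ^ 56) := by
        rw [Real.exp_sub, Real.exp_add, Real.exp_add]
        gcongr
        push_cast; exact hN111
      have h6 := mul_le_mul (h3.trans h5) h4 (by positivity) (Real.exp_pos _).le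
      have h8 := h6.trans (Real.exp_add _ _).ge
      have h7 := exp_neg_small (y := -(n + n + 200 * K - (n : ℝ) ^ 56 + 3888 * K)) (by rw [p2]; nlinarith)
      rw [neg_neg] at h7
      exact absurd (h1.trans (h8.trans h7)) (by norm_num)
    | succ i ih =>
      intro hi
      have hprev := ih (by omega)
      have hM : (6 - (i + 1)) * n ^ 54 + n ^ 54 = (6 - i) * n ^ 54 := by
        rw [← Nat.succ_mul]; congr 1; omega
      have hM6 : (6 - i) * n ^ 54 ≤ 6 * n ^ 54 := Nat.mul_le_mul_right _ (by omega)
      have e17 : 2 + 15 * (i + 1) = 17 + 15 * i := by ring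
      rw [e17]
      set Z : ℝ := (n : ℝ) ^ (55 + 15 * i) with hZ
      have hKZ : K ≤ Z := npow _ _ (by omega)
      have hLS : ((n ^ 37 * n ^ (17 + 15 * i) : ℕ) : ℝ) = (n : ℝ) ^ (54 + 15 * i) := by
        push_cast; rw [← pow_add]; congr 1; ring
      have hLSn : (n : ℝ) * (n : ℝ) ^ (54 + 15 * i) = Z := by rw [hZ]; ring
      have hLSZ : (n : ℝ) ^ (54 + 15 * i) ≤ Z := npow _ _ (by omega)
      refine core_step θ k h g τ hg hτ (by linarith) (by linarith) p (n ^ (2 + 15 * i)) (n ^ (17 + 15 * i))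
        ((6 - (i + 1)) * n ^ 54) (n ^ 54) (nn _ _ (by omega)) W
        ((W * Real.exp (3 * n * ((n ^ 37 * n ^ (17 + 15 * i) : ℕ) : ℝ))) ^ 18) _ (by positivity)
        (fun m1 m3 hm => hW m1 m3 (by omega)) hδ (fun m1 m3 l hm hl hne => hL _ m1 m3 l (by omega) hl hne)
        (by positivity) (by positivity) ?_ (fun l hl m1 m3 hm => hprev l hl m1 m3 (by omega))
      refine step_num n Z _ _ _ _ _ _ _ _ ((n : ℝ) ^ 119) ?_ ?_ ?_ ?_ ?_ le_rfl ?_ ?_ nR ?_ ?_ ?_ ?_ ?_ ?_ ?_ ?_ ?_ ?_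
      · exact Real.exp_le_exp.2 (by linarith)
      · apply Real.exp_le_exp.2
        have : 20 * ((n ^ 37 : ℕ) : ℝ) * (7 * ((n ^ (17 + 15 * i) : ℕ) : ℝ)) = 140 * (n : ℝ) ^ (54 + 15 * i) := by
          rw [← hLS]; push_cast; ring
        rw [this]; linarith
      · refine (third_pow_le_exp _).trans (le_of_eq ?_)
        congr 2
        push_cast
        rw [hZ]; ring
      · refine (eleven_pow_le_exp _).trans (Real.exp_le_exp.2 ?_)
        have : (n : ℝ) ^ 54 ≤ Z := npow _ _ (by omega)
        push_cast; linarith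
      · have h1 := two_pow_le_exp (n ^ 37 * n ^ (17 + 15 * i))
        have h2 := (Real.add_one_le_exp ((n ^ 37 * n ^ (17 + 15 * i) : ℕ) : ℝ))
        calc _ ≤ Real.exp ((n ^ 37 * n ^ (17 + 15 * i) : ℕ) : ℝ) * Real.exp ((n ^ 37 * n ^ (17 + 15 * i) : ℕ) : ℝ) := by
              gcongr; linarith
          _ = Real.exp (2 * (n : ℝ) ^ (54 + 15 * i)) := by rw [← Real.exp_add, hLS]; ring_nf
          _ ≤ _ := by apply Real.exp_le_exp.2; linarith
      · have h1 : (((n ^ 54 : ℕ) : ℝ) + 3) * ((n ^ (17 + 15 * i) : ℕ) : ℝ) ≤ Real.exp n := by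
          refine le_trans ?_ hbig
          push_cast
          calc ((n : ℝ) ^ 54 + 3) * (n : ℝ) ^ (17 + 15 * i) ≤ (n : ℝ) ^ 55 * (n : ℝ) ^ 77 := by
                gcongr
                · have : (1 : ℝ) ≤ (n : ℝ) ^ 54 := one_le_pow₀ n1
                  calc (n : ℝ) ^ 54 + 3 ≤ n * (n : ℝ) ^ 54 := by nlinarith
                    _ = _ := by ring
                · omega
            _ = (n : ℝ) ^ 132 := by ring
            _ ≤ _ := npow _ _ (by norm_num)
        calc _ ≤ Real.exp n ^ (n ^ (2 + 15 * i) * n ^ 54) := by gcongr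
          _ = _ := by
            rw [← Real.exp_nat_mul]; congr 1; push_cast; rw [hZ]; ring
      · rw [hWdef, ← Real.exp_add, ← Real.exp_nat_mul]
        apply Real.exp_le_exp.2
        rw [hLS, mul_assoc 3, hLSn]
        push_cast
        linarith
      · exact one_le_pow₀ n1
      · calc (n : ℝ) * ((n : ℝ) ^ 2 * Z) = (n : ℝ) ^ (58 + 15 * i) := by rw [hZ]; ring
          _ ≤ _ := npow _ _ (by omega)
      all_goals positivity
  apply hp0
  apply core_final g τ k h p hind
  intro l hl m3 hm3
  refine main 5 le_rfl l ?_ 0 m3 ?_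
  · calc l < n ^ 37 * n ^ 37 := hl
      _ = n ^ 74 := by ring
      _ ≤ _ := nn _ _ (by norm_num)
  · have := nn 37 54 (by norm_num)
    simp only [Nat.reduceSub, one_mul]; omega

noncomputable def Fc (k : ℕ) : ℂ := (qE be * be ^ k + qE ga * ga ^ k) / 44

theorem qE_prod : qE (al : ℂ) * qE be * qE ga = 44 ^ 2 := by
  have hg : ga = 1 - al - be := by linear_combination sum1
  have h1 := sum2
  have h2 := prod1
  have e1 := sum1
  unfold qE
  have s1 : (al : ℂ) ^ 2 + be ^ 2 + ga ^ 2 = 3 := by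
    linear_combination ((al : ℂ) + be + ga + 1) * e1 - 2 * h1
  have A := al_eqC
  have B := be_eq
  have C := ga_eq
  have q : (al : ℂ) ^ 2 * be ^ 2 + be ^ 2 * ga ^ 2 + ga ^ 2 * al ^ 2 = -1 := by
    linear_combination ((al : ℂ) * be + be * ga + ga * al - 1) * h1 - 2 * (al + be + ga) * h2 - 2 * e1
  have r : (al : ℂ) ^ 2 * be ^ 2 * ga ^ 2 = 1 := by
    linear_combination ((al : ℂ) * be * ga + 1) * h2
  have m1 : (al : ℂ) ^ 2 * (be + ga) + be ^ 2 * (ga + al) + ga ^ 2 * (al + be) = -4 := by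
    linear_combination ((al : ℂ) * be + be * ga + ga * al) * e1 + h1 - 3 * h2
  have m2 : (al : ℂ) ^ 2 * be * ga + be ^ 2 * al * ga + ga ^ 2 * al * be = 1 := by
    linear_combination ((al : ℂ) + be + ga) * h2 + e1
  have m3 : (al : ℂ) ^ 2 * be ^ 2 * ga + (al : ℂ) ^ 2 * be * ga ^ 2 + (al : ℂ) * be ^ 2 * ga ^ 2 = -1 := by
    linear_combination ((al : ℂ) * be + be * ga + ga * al) * h2 + h1
  linear_combination 72 * e1 - 32 * s1 + 648 * h1 - 288 * m1 + 128 * q + 5832 * h2 - 2592 * m2 + 1152 * m3 - 512 * r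

theorem Bk (n : ℕ) (hn : 10000 ≤ n) (hbig : (n : ℝ) ^ 200 ≤ Real.exp n) (P : Polynomial ℤ)
    (hP : ∀ ρ : ℂ, ρ ^ 3 = ρ ^ 2 + ρ + 1 → ‖Polynomial.aeval ρ P‖ ≤ Real.exp n)
    (k : ℕ) (hk1 : 1 ≤ k) (hk : (k : ℝ) ≤ Real.exp n) :
    Real.exp (-(n : ℝ) ^ 120) ≤ ‖qE (al : ℂ) * al ^ k * Fc k ^ 2 - 2 - Polynomial.aeval (al : ℂ) P‖ := by
  by_contra! hcon
  have na := qE_ne al_eqC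
  have nb := qE_ne be_eq
  have nc := qE_ne ga_eq
  have hb := pow_ne_zero k be_ne
  have hc := pow_ne_zero k ga_ne
  set p := Polynomial.aeval (al : ℂ) P with hp
  set χt : ℂ := (qE be / qE ga) * (be ^ k / ga ^ k) with hχt
  have hqn : ‖qE be‖ = ‖qE ga‖ := by
    have : qE ga = (starRingEnd ℂ) (qE be) := by rw [ga_conj]; unfold qE; simp only [map_sub, map_add, map_mul, map_pow, map_ofNat]
    rw [this, Complex.norm_conj]
  have hbn : ‖be ^ k‖ = ‖ga ^ k‖ := by rw [norm_pow, norm_pow, norm_be_ga]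
  have hbc0 : ‖ga ^ k‖ ≠ 0 := norm_ne_zero_iff.2 hc
  have hqc0 : ‖qE ga‖ ≠ 0 := norm_ne_zero_iff.2 nc
  have hχ1 : ‖χt‖ = 1 := by
    rw [hχt, norm_mul, norm_div, norm_div, hqn, hbn, div_self hqc0, div_self hbc0, one_mul]
  have hχ0 : χt ≠ 0 := by intro h; rw [h, norm_zero] at hχ1; norm_num at hχ1
  have hprod : qE (al : ℂ) * al ^ k * (qE be * be ^ k) * (qE ga * ga ^ k) = 44 ^ 2 := by
    have h1 : (al : ℂ) ^ k * be ^ k * ga ^ k = 1 := by rw [← mul_pow, ← mul_pow, prod1, one_pow]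
    linear_combination (al : ℂ) ^ k * be ^ k * ga ^ k * qE_prod + 44 ^ 2 * h1
  have hν : χt * (qE (al : ℂ) * al ^ k * Fc k ^ 2 - 2) = χt ^ 2 + 1 := by
    have hq : qE (al : ℂ) * al ^ k = 44 ^ 2 / ((qE be * be ^ k) * (qE ga * ga ^ k)) := by
      rw [eq_div_iff (by positivity)]; linear_combination hprod
    rw [hq, hχt, Fc]
    field_simp
    ring
  obtain ⟨χ, hχ⟩ : ∃ χ : ℂ, χ ^ 2 - p * χ + 1 = 0 := by
    obtain ⟨s, hs⟩ := IsAlgClosed.exists_pow_nat_eq (p ^ 2 - 4) (n := 2) (by norm_num)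
    exact ⟨(p + s) / 2, by linear_combination hs / 4⟩
  have hfac : (χt - χ) * (χt - (p - χ)) = χt * (qE (al : ℂ) * al ^ k * Fc k ^ 2 - 2 - p) := by
    linear_combination -hν - hχ
  have hχ' : (p - χ) ^ 2 - p * (p - χ) + 1 = 0 := by linear_combination hχ
  have hfn : ‖χt - χ‖ * ‖χt - (p - χ)‖ < Real.exp (-(n : ℝ) ^ 120) := by
    rw [← norm_mul, hfac, norm_mul, hχ1, one_mul]; exact hcon
  have nR : (10000 : ℝ) ≤ n := by exact_mod_cast hn
  have hsq : Real.exp (-(n : ℝ) ^ 120) ≤ Real.exp (-(n : ℝ) ^ 119) * Real.exp (-(n : ℝ) ^ 119) := by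
    rw [← Real.exp_add]
    apply Real.exp_le_exp.2
    have : (0 : ℝ) ≤ (n : ℝ) ^ 119 := by positivity
    have e : (n : ℝ) ^ 120 = n * (n : ℝ) ^ 119 := by ring
    rw [e]; nlinarith
  have key : ∀ χ : ℂ, χ ^ 2 - p * χ + 1 = 0 → Real.exp (-(n : ℝ) ^ 119) < ‖χt - χ‖ := by
    intro χ hχ
    by_contra! hle
    refine core_contra n hn hbig P hP χ hχ k hk1 hk (le_trans (le_of_eq ?_) hle)
    have e : qD be / qD ga = qE ga / qE be := by
      rw [div_eq_div_iff (qD_ne ga_eq) nb, qDE be_eq, mul_comm, qDE ga_eq]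
    rw [tau_eq, e, g_eq, div_pow]
    have : be ^ k / ga ^ k - χ * (qE ga / qE be) = (qE ga / qE be) * (χt - χ) := by
      rw [hχt]; field_simp
    rw [this, norm_mul, norm_div, hqn, div_self hqc0, one_mul]
  have k1 := key _ hχ
  have k2 := key _ hχ'
  have := mul_lt_mul'' k1 k2 (Real.exp_pos _).le (Real.exp_pos _).le
  linarith

noncomputable def ap : ℝ := qE al / 44
noncomputable def th : ℝ := ‖be‖
noncomputable def Fr (n : ℕ) : ℝ := (T n : ℝ) - ap * al ^ n

theorem th_sq : th ^ 2 = 1 / al := norm_be_sq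
theorem th_pos : 0 < th := norm_be_pos
theorem th_lt : th < 1 := norm_be_lt
theorem qEal_bd : 8 < qE al ∧ qE al < 8.2 := by
  have h1 := al_gt
  have h2 := al_lt
  unfold qE
  constructor <;> nlinarith
theorem ap_bd : 0.18 < ap ∧ ap < 0.19 := by
  have := qEal_bd
  unfold ap
  constructor
  · rw [lt_div_iff₀ (by norm_num)]; linarith
  · rw [div_lt_iff₀ (by norm_num)]; linarith
theorem qE_cast : ((qE al : ℝ) : ℂ) = qE (al : ℂ) := by unfold qE; push_cast; ring
theorem Fr_eq (n : ℕ) : (Fr n : ℂ) = Fc n := by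
  have := binet n
  unfold Fr Fc ap
  push_cast
  rw [qE_cast]
  linear_combination this / 44

theorem al_th (n : ℕ) : al ^ n * th ^ (2 * n) = 1 := by
  rw [pow_mul, ← mul_pow, th_sq, mul_one_div_cancel al_pos.ne', one_pow]

theorem Fr_sq (n : ℕ) : qE al * Fr n ^ 2 * al ^ n ≤ 4 := by
  have h0 : |Fr n| = ‖Fc n‖ := by rw [← Fr_eq, Complex.norm_real, Real.norm_eq_abs]
  have hqn : ‖qE be‖ = ‖qE ga‖ := by
    have : qE ga = (starRingEnd ℂ) (qE be) := by
      rw [ga_conj]; unfold qE; simp only [map_sub, map_add, map_mul, map_pow, map_ofNat]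
    rw [this, Complex.norm_conj]
  have h1 : ‖Fc n‖ ≤ 2 * ‖qE be‖ * th ^ n / 44 := by
    unfold Fc
    rw [norm_div]
    have : ‖(44 : ℂ)‖ = 44 := by norm_num
    rw [this]
    gcongr
    refine (norm_add_le _ _).trans (le_of_eq ?_)
    rw [norm_mul, norm_mul, norm_pow, norm_pow, ← hqn, ← norm_be_ga, th]; ring
  have h2 : qE al * ‖qE be‖ ^ 2 = 44 ^ 2 := by
    have := congrArg norm qE_prod
    rw [norm_mul, norm_mul, ← hqn, ← qE_cast, Complex.norm_real, Real.norm_eq_abs, abs_of_pos (by linarith [qEal_bd.1])] at this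
    rw [pow_two, ← mul_assoc, this]; norm_num
  have h3 : Fr n ^ 2 ≤ (2 * ‖qE be‖ * th ^ n / 44) ^ 2 := by
    rw [← sq_abs, h0]; gcongr
  have hq := qEal_bd.1
  have ha := pow_pos al_pos n
  calc qE al * Fr n ^ 2 * al ^ n ≤ qE al * (2 * ‖qE be‖ * th ^ n / 44) ^ 2 * al ^ n := by gcongr
    _ = 4 / 44 ^ 2 * (qE al * ‖qE be‖ ^ 2) * (al ^ n * th ^ (2 * n)) := by ring
    _ = 4 := by rw [h2, al_th]; norm_num

theorem Fr_le (n : ℕ) : |Fr n| ≤ th ^ n := by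
  have h1 := Fr_sq n
  have hq := qEal_bd.1
  have h2 := al_th n
  have ha := pow_pos al_pos n
  have ht := pow_pos th_pos n
  apply abs_le_of_sq_le_sq _ ht.le
  rw [← pow_mul, mul_comm n 2]
  have h3 : Fr n ^ 2 * al ^ n ≤ th ^ (2 * n) * al ^ n := by
    have : 0 ≤ Fr n ^ 2 * al ^ n := by positivity
    nlinarith
  exact le_of_mul_le_mul_right h3 ha

theorem th_anti {m n : ℕ} (h : m ≤ n) : th ^ n ≤ th ^ m := pow_le_pow_of_le_one th_pos.le th_lt.le h
theorem T_eq (n : ℕ) : (T n : ℝ) = ap * al ^ n + Fr n := by unfold Fr; ring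

theorem s_abs (s δ ε η m r Fx Fy Fz : ℝ)
    (hs : s * (1 + r * (Fz - 1)) = (Fz - 1) * (δ * ε) - ε * (Fy - 1) - (Fx - 1) - (Fx - 1) * (Fy - 1) * m)
    (d0 : 0 ≤ δ) (d1 : δ ≤ 1) (e0 : 0 ≤ ε) (e1 : ε ≤ 1) (hx : |Fx| ≤ η) (hy : |Fy| ≤ η) (hz : |Fz| ≤ η)
    (h1 : η ≤ 1) (m0 : 0 ≤ m) (hm : m ≤ 6 * η) (r0 : 0 ≤ r) (hr : r ≤ 6 * η) (hr4 : r ≤ 1 / 4) :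
    |s - (1 + ε - δ * ε)| ≤ 102 * η := by
  have η0 : 0 ≤ η := (abs_nonneg _).trans hx
  have fx : |Fx - 1| ≤ 2 := by rw [abs_le] at *; constructor <;> linarith
  have fy : |Fy - 1| ≤ 2 := by rw [abs_le] at *; constructor <;> linarith
  have fz : |Fz - 1| ≤ 2 := by rw [abs_le] at *; constructor <;> linarith
  have key : (s - (1 + ε - δ * ε)) * (1 + r * (Fz - 1)) = Fz * (δ * ε) - ε * Fy - Fx
      - (Fx - 1) * (Fy - 1) * m - (1 + ε - δ * ε) * (r * (Fz - 1)) := by linear_combination hs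
  have hrz : |r * (Fz - 1)| ≤ 12 * η := by
    rw [abs_mul, abs_of_nonneg r0]; nlinarith [abs_nonneg (Fz - 1)]
  have hrz2 : |r * (Fz - 1)| ≤ 1 / 2 := by
    rw [abs_mul, abs_of_nonneg r0]; nlinarith [abs_nonneg (Fz - 1)]
  have hde : δ * ε ≤ 1 := mul_le_one₀ d1 e0 e1
  have hde0 : 0 ≤ δ * ε := by positivity
  have hde2 : δ * ε ≤ ε := by nlinarith
  have b1 : |Fz * (δ * ε)| ≤ η := by
    rw [abs_mul, abs_of_nonneg hde0]; nlinarith [abs_nonneg Fz]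
  have b2 : |ε * Fy| ≤ η := by
    rw [abs_mul, abs_of_nonneg e0]; nlinarith [abs_nonneg Fy]
  have b3 : |(Fx - 1) * (Fy - 1) * m| ≤ 24 * η := by
    rw [abs_mul, abs_mul, abs_of_nonneg m0]
    have : |Fx - 1| * |Fy - 1| ≤ 2 * 2 := by gcongr
    calc _ ≤ (2 * 2) * (6 * η) := by gcongr
      _ = _ := by ring
  have b4 : |(1 + ε - δ * ε) * (r * (Fz - 1))| ≤ 24 * η := by
    rw [abs_mul, abs_of_nonneg (by linarith)]
    calc _ ≤ 2 * (12 * η) := by gcongr; linarith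
      _ = _ := by ring
  have hR : |(s - (1 + ε - δ * ε)) * (1 + r * (Fz - 1))| ≤ 51 * η := by
    rw [key]
    rw [abs_le] at b1 b2 b3 b4 hx ⊢
    constructor <;> linarith
  rw [abs_mul] at hR
  have hL : 1 / 2 ≤ |1 + r * (Fz - 1)| := by
    rw [abs_le] at hrz2
    exact le_trans (by linarith) (le_abs_self _)
  nlinarith [abs_nonneg (s - (1 + ε - δ * ε))]

def Sol (k d e u v w : ℕ) : Prop := 1 ≤ u ∧ u < v ∧ v < w ∧ 1 ≤ k ∧ 1 ≤ d ∧ 1 ≤ e ∧ 1 + u * v = T (k + d) ∧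
  1 + u * w = T (k + d + e) ∧ 1 + v * w = T (k + 2 * d + e)

theorem T_small {n : ℕ} (h : 3 ≤ T n) : 5 ≤ n := by
  by_contra! h2
  interval_cases n <;> simp [T] at h

theorem sol_s {k d e u v w : ℕ} (h : Sol k d e u v w) :
    |(ap * al ^ k - (u : ℝ) ^ 2) * al ^ d - (1 + th ^ (2 * e) - th ^ (2 * d) * th ^ (2 * e))| ≤ 102 * th ^ (k + d) := by
  obtain ⟨hu, huv, hvw, hk, hd, he, hx, hy, hz⟩ := h
  have hx5 : 5 ≤ k + d := by
    apply T_small; rw [← hx]; nlinarith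
  have hxr : (u : ℝ) * v = ap * al ^ (k + d) + Fr (k + d) - 1 := by
    rw [← T_eq, ← hx]; push_cast; ring
  have hyr : (u : ℝ) * w = ap * al ^ (k + d + e) + Fr (k + d + e) - 1 := by
    rw [← T_eq, ← hy]; push_cast; ring
  have hzr : (v : ℝ) * w = ap * al ^ (k + 2 * d + e) + Fr (k + 2 * d + e) - 1 := by
    rw [← T_eq, ← hz]; push_cast; ring
  have hE : (u : ℝ) ^ 2 * (v * w) = (u * v) * (u * w) := by ring
  rw [hxr, hyr, hzr] at hE
  have hA := al_th d
  have hB := al_th e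
  have ha := ap_bd.1
  have hy1 : al ^ (k + d + e) = al ^ k * al ^ d * al ^ e := by ring
  have hx1 : al ^ (k + d) = al ^ k * al ^ d := by ring
  have hz1 : al ^ (k + 2 * d + e) = al ^ k * al ^ d ^ 1 * al ^ d * al ^ e := by ring
  have h1 : ∀ n, k + d ≤ n → 1 / (ap * al ^ n) ≤ 6 * th ^ (k + d) := by
    intro n hn
    have e1 := al_th n
    have p1 := pow_pos al_pos n
    rw [div_le_iff₀ (by positivity)]
    have e2 : th ^ (2 * n) ≤ th ^ (k + d) := th_anti (by omega)
    have : 1 ≤ th ^ (k + d) * al ^ n := by rw [← e1, mul_comm]; gcongr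
    nlinarith
  have hz4 : 1 / (ap * al ^ (k + 2 * d + e)) ≤ 1 / 4 := by
    apply one_div_le_one_div_of_le (by norm_num)
    have e3 : al ^ 6 ≤ al ^ (k + 2 * d + e) := pow_le_pow_right₀ (by linarith [al_gt]) (by omega)
    have e4 : (1.8 : ℝ) ^ 6 ≤ al ^ 6 := by gcongr; linarith [al_gt]
    norm_num at e4
    nlinarith
  have hap : 0 < ap := by linarith
  refine s_abs _ _ _ _ (1 / (ap * al ^ (k + d + e))) (1 / (ap * al ^ (k + 2 * d + e))) _ _ _ ?_ (by have := th_pos; positivity)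
    (pow_le_one₀ th_pos.le th_lt.le) (by have := th_pos; positivity)
    (pow_le_one₀ th_pos.le th_lt.le) (Fr_le (k + d)) ((Fr_le (k + d + e)).trans (th_anti (by omega)))
    ((Fr_le (k + 2 * d + e)).trans (th_anti (by omega))) (pow_le_one₀ th_pos.le th_lt.le)
    (by have := al_pos; positivity) (h1 _ (by omega)) (by have := al_pos; positivity) (h1 _ (by omega)) hz4
  rw [pow_one] at hz1
  rw [hx1, hy1, hz1] at hE
  rw [hy1, hz1]
  clear hx1 hy1 hz1 hz4 hxr hyr hzr h1
  have pA := (pow_pos al_pos k).ne'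
  have pX := (pow_pos al_pos d).ne'
  have pY := (pow_pos al_pos e).ne'
  have hd1 : th ^ (2 * d) = 1 / al ^ d := by rw [eq_div_iff pX, mul_comm, hA]
  have he1 : th ^ (2 * e) = 1 / al ^ e := by rw [eq_div_iff pY, mul_comm, hB]
  rw [hd1, he1]
  generalize al ^ k = A at *
  generalize al ^ d = X at *
  generalize al ^ e = Y at *
  field_simp
  linear_combination -hE

theorem sol_big {k d e u v w : ℕ} (h : Sol k d e u v w) (hsm : 5000 * th ^ k ≤ 1) (hk : 1 ≤ k) :
    ∃ j : ℕ, ∃ s : ℝ, 2 * d = k + j ∧ |s - (1 + th ^ (2 * e) - th ^ (2 * d) * th ^ (2 * e))| ≤ 102 * th ^ k ∧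
      0.95 ≤ s ∧ s ≤ 1.6 ∧ qE al * al ^ k * Fr k ^ 2 = qE al * th ^ (2 * j) * s ^ 2 := by
  have hs := sol_s h
  obtain ⟨hu, huv, hvw, -, hd, he, -, -, -⟩ := h
  have hη : th ^ (k + d) ≤ th ^ k := th_anti (by omega)
  have tp := th_pos
  have ht2 : th ^ 2 < 0.55 := by
    rw [th_sq, div_lt_iff₀ al_pos]; linarith [al_gt]
  have hδ : th ^ (2 * d) < 0.55 := (th_anti (by omega)).trans_lt ht2
  have hε : th ^ (2 * e) < 0.55 := (th_anti (by omega)).trans_lt ht2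
  have hδ0 : 0 < th ^ (2 * d) := by positivity
  have hε0 : 0 < th ^ (2 * e) := by positivity
  obtain ⟨s, hsd⟩ : ∃ s, s = (ap * al ^ k - (u : ℝ) ^ 2) * al ^ d := ⟨_, rfl⟩
  rw [← hsd] at hs
  have hp : ap * al ^ k - (u : ℝ) ^ 2 = s * th ^ (2 * d) := by
    rw [hsd, mul_assoc, al_th, mul_one]
  have hs1 : |s - (1 + th ^ (2 * e) - th ^ (2 * d) * th ^ (2 * e))| ≤ 102 * th ^ k := by linarith
  have hs2 := abs_le.1 hs1
  have hde : 0 < th ^ (2 * d) * th ^ (2 * e) := by positivity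
  have hde2 : th ^ (2 * d) * th ^ (2 * e) ≤ th ^ (2 * e) := by nlinarith
  have s1 : 0.95 ≤ s := by linarith
  have s2 : s ≤ 1.6 := by linarith
  have hF := abs_le.1 (Fr_le k)
  have hT := T_eq k
  have hsδ : s * th ^ (2 * d) ≤ 1.6 * 0.55 := by gcongr
  have hsδ0 : 0 < s * th ^ (2 * d) := by positivity
  have hTu : (T k : ℤ) - (u : ℤ) ^ 2 = 0 := by
    have h1 : ((T k : ℤ) - (u : ℤ) ^ 2 : ℝ) = s * th ^ (2 * d) + Fr k := by
      rw [← hp]; push_cast; rw [hT]; ring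
    have h2 : ((T k : ℤ) - (u : ℤ) ^ 2 : ℝ) < 1 := by linarith
    have h3 : (-1 : ℝ) < ((T k : ℤ) - (u : ℤ) ^ 2 : ℝ) := by linarith
    have h2' : (T k : ℤ) - (u : ℤ) ^ 2 < 1 := by exact_mod_cast h2
    have h3' : -1 < (T k : ℤ) - (u : ℤ) ^ 2 := by exact_mod_cast h3
    omega
  have hTu' : (T k : ℝ) = (u : ℝ) ^ 2 := by
    have : (T k : ℤ) = (u : ℤ) ^ 2 := by linarith
    exact_mod_cast this
  have hFs : Fr k = -(s * th ^ (2 * d)) := by rw [← hp]; linarith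
  have hsq := Fr_sq k
  have hqE := qEal_bd.1
  have hak := pow_pos al_pos k
  have hkd : k < 2 * d := by
    by_contra! hc
    have h1 := al_th (2 * d)
    have h2 : al ^ (2 * d) ≤ al ^ k := pow_le_pow_right₀ (by linarith [al_gt]) hc
    have e4 : th ^ (2 * (2 * d)) = th ^ (2 * d) * th ^ (2 * d) := by ring
    rw [e4] at h1
    have h3 : 1 ≤ al ^ k * (th ^ (2 * d) * th ^ (2 * d)) := by rw [← h1]; gcongr
    have h4 : qE al * Fr k ^ 2 * al ^ k = qE al * s ^ 2 * (al ^ k * (th ^ (2 * d) * th ^ (2 * d))) := by rw [hFs]; ring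
    rw [h4] at hsq
    have h5 : 8 * 0.95 ^ 2 * 1 ≤ qE al * s ^ 2 * (al ^ k * (th ^ (2 * d) * th ^ (2 * d))) := by gcongr
    norm_num at h5
    linarith
  obtain ⟨j, hj⟩ := Nat.exists_eq_add_of_lt hkd
  refine ⟨j + 1, s, by omega, hs1, s1, s2, ?_⟩
  have e5 : th ^ (2 * d) * th ^ (2 * d) = th ^ (2 * k) * th ^ (2 * (j + 1)) := by
    rw [← pow_add, ← pow_add]; congr 1; omega
  rw [hFs]
  have := al_th k
  linear_combination qE al * al ^ k * s ^ 2 * e5 + qE al * s ^ 2 * th ^ (2 * (j + 1)) * this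

open Polynomial in
noncomputable def Ep : ℤ[X] := 2 + 18 * X - 8 * X ^ 2
open Polynomial in
noncomputable def Vp : ℤ[X] := X ^ 2 - X - 1

theorem aeval_Ep (ρ : ℂ) : Polynomial.aeval ρ Ep = qE ρ := by
  unfold Ep qE
  simp only [map_sub, map_add, map_mul, map_pow, map_ofNat, Polynomial.aeval_X]
theorem aeval_Vp (ρ : ℂ) : Polynomial.aeval ρ Vp = ρ ^ 2 - ρ - 1 := by
  unfold Vp; simp
theorem aeval_Vp_al : Polynomial.aeval (al : ℂ) Vp = ((th ^ 2 : ℝ) : ℂ) := by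
  rw [aeval_Vp, th_sq]
  push_cast
  rw [eq_div_iff al_ne]
  linear_combination al_eqC
theorem norm_Vp {ρ : ℂ} (h : ρ ^ 3 = ρ ^ 2 + ρ + 1) : ‖Polynomial.aeval ρ Vp‖ ≤ 7 := by
  rw [aeval_Vp]
  have h1 := norm_root_le h
  have h2 := norm_sub_le (ρ ^ 2 - ρ) 1
  have h3 := norm_sub_le (ρ ^ 2) ρ
  rw [norm_pow] at h3
  rw [norm_one] at h2
  nlinarith [norm_nonneg ρ]

theorem BkR (n : ℕ) (hn : 10000 ≤ n) (hbig : (n : ℝ) ^ 200 ≤ Real.exp n) (Q : Polynomial ℤ) (j : ℕ) (s q B : ℝ)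
    (hQ : ∀ ρ : ℂ, ρ ^ 3 = ρ ^ 2 + ρ + 1 → ‖Polynomial.aeval ρ Q‖ ≤ B) (hB : 70 * 7 ^ j * B + 2 ≤ Real.exp n)
    (hq : Polynomial.aeval (al : ℂ) Q = (q : ℂ))
    (k : ℕ) (hk1 : 1 ≤ k) (hk : (k : ℝ) ≤ Real.exp n)
    (hs : qE al * al ^ k * Fr k ^ 2 = qE al * th ^ (2 * j) * s ^ 2) :
    Real.exp (-(n : ℝ) ^ 120) ≤ 8.2 * th ^ (2 * j) * |s ^ 2 - q| := by
  have h := Bk n hn hbig (Ep * Vp ^ j * Q - 2) (by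
    intro ρ hρ
    have h1 := norm_Vp hρ
    have h2 := norm_qE_le (norm_root_le hρ)
    have h3 := hQ ρ hρ
    simp only [map_sub, map_mul, map_pow, map_ofNat, aeval_Ep]
    refine (norm_sub_le _ _).trans (le_trans ?_ hB)
    have : ‖(2 : ℂ)‖ = 2 := by norm_num
    rw [norm_mul, norm_mul, norm_pow, this]
    gcongr) k hk1 hk
  refine h.trans ?_
  simp only [map_sub, map_mul, map_pow, map_ofNat, aeval_Ep, hq, aeval_Vp_al]
  rw [← Fr_eq, ← qE_cast]
  have : ((qE al : ℝ) : ℂ) * al ^ k * (Fr k : ℂ) ^ 2 - 2 - ((qE al : ℝ) * ((th ^ 2 : ℝ) : ℂ) ^ j * q - 2)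
     = ((qE al * th ^ (2 * j) * (s ^ 2 - q) : ℝ) : ℂ) := by
    have hs' : (((qE al * al ^ k * Fr k ^ 2 : ℝ)) : ℂ) = ((qE al * th ^ (2 * j) * s ^ 2 : ℝ) : ℂ) := by rw [hs]
    push_cast at hs' ⊢
    rw [← pow_mul]
    linear_combination hs'
  have tp := th_pos
  have hqE := qEal_bd
  have q0 : 0 < qE al := by linarith
  rw [this, Complex.norm_real, Real.norm_eq_abs, abs_mul, abs_of_pos (by positivity)]
  gcongr
  exact hqE.2.le

theorem th_exp (k : ℕ) : th ^ k ≤ Real.exp (-((k : ℝ) / 4)) := by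
  have h : th ≤ Real.exp (-(1 / 4)) := by
    have h4 : th ^ 4 ≤ Real.exp (-(1 / 4)) ^ 4 := by
      rw [← Real.exp_nat_mul]
      have e1 : ((4 : ℕ) : ℝ) * (-(1 / 4)) = -1 := by norm_num
      have e2 : th ^ 4 = (th ^ 2) ^ 2 := by ring
      rw [e1, e2, th_sq, Real.exp_neg, div_pow, one_pow, inv_eq_one_div]
      apply one_div_le_one_div_of_le (Real.exp_pos _)
      nlinarith [Real.exp_one_lt_d9, al_gt]
    exact le_of_pow_le_pow_left₀ (by norm_num) (Real.exp_pos _).le h4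
  calc th ^ k ≤ Real.exp (-(1 / 4)) ^ k := by gcongr; exact th_pos.le
    _ = _ := by rw [← Real.exp_nat_mul]; ring_nf

theorem nat_le_exp (c m : ℕ) (h : (c : ℝ) ≤ 2.7 ^ m) : (c : ℝ) ≤ Real.exp m := by
  refine h.trans ?_
  rw [← mul_one (m : ℝ), Real.exp_nat_mul]
  gcongr
  linarith [Real.exp_one_gt_d9]

theorem seven_pow (j : ℕ) : (7 : ℝ) ^ j ≤ Real.exp (2 * j) := by
  rw [mul_comm, Real.exp_nat_mul]
  gcongr
  have := nat_le_exp 7 2 (by norm_num)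
  exact_mod_cast this

theorem pow_bd (n : ℝ) (hn : 10000 ≤ n) : n ≤ n ^ 120 ∧ 10000 * n ^ 120 ≤ n ^ 121 ∧ 10000 ≤ n ^ 120 := by
  have h1 : n ^ 1 ≤ n ^ 120 := pow_le_pow_right₀ (by linarith) (by norm_num)
  rw [pow_one] at h1
  refine ⟨h1, ?_, by linarith⟩
  have : n ^ 121 = n * n ^ 120 := by ring
  rw [this]
  gcongr

theorem exp_bd {N C : ℝ} {j : ℕ} (h : Real.exp (-N) ≤ C * th ^ (2 * j)) (hC : C ≤ 100) : (j : ℝ) ≤ 2 * N + 10 := by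
  have h1 := th_exp (2 * j)
  have h2 := nat_le_exp 100 5 (by norm_num)
  have h3 : Real.exp (-N) ≤ Real.exp (5 + -(((2 * j : ℕ) : ℝ) / 4)) := by
    rw [Real.exp_add]
    have tp := th_pos
    calc _ ≤ C * th ^ (2 * j) := h
      _ ≤ Real.exp 5 * Real.exp (-(((2 * j : ℕ) : ℝ) / 4)) := by
        gcongr
        push_cast at h2; linarith
  have h4 := Real.exp_le_exp.1 h3
  push_cast at h4
  linarith

set_option maxHeartbeats 2000000 in
theorem klarge {k d e u v w : ℕ} (h : Sol k d e u v w) (N0 : ℕ)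
    (hN : ∀ n : ℕ, N0 ≤ n → (n : ℝ) ^ 200 ≤ Real.exp n)
    (n1 n2 n3 : ℕ) (h10 : 10000 ≤ n1) (h1N : N0 ≤ n1) (h2 : n2 = n1 ^ 121) (h3 : n3 = n2 ^ 121)
    (hk : (k : ℝ) ≤ Real.exp n1) (hkl : 4 * ((n3 : ℝ) ^ 120 + 9) < k) : False := by
  have hk1 : 1 ≤ k := h.2.2.2.1
  have he1 : 1 ≤ e := h.2.2.2.2.2.1
  have h12 : n1 ≤ n2 := by rw [h2]; exact Nat.le_self_pow (by norm_num) _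
  have h23 : n2 ≤ n3 := by rw [h3]; exact Nat.le_self_pow (by norm_num) _
  have h2r : (n2 : ℝ) = (n1 : ℝ) ^ 121 := by rw [h2]; push_cast; rfl
  have h3r : (n3 : ℝ) = (n2 : ℝ) ^ 121 := by rw [h3]; push_cast; rfl
  have r1 : (10000 : ℝ) ≤ n1 := by exact_mod_cast h10
  have r12 : (n1 : ℝ) ≤ n2 := by exact_mod_cast h12
  have r23 : (n2 : ℝ) ≤ n3 := by exact_mod_cast h23
  obtain ⟨a1, b1, c1⟩ := pow_bd n1 r1
  obtain ⟨a2, b2, c2⟩ := pow_bd n2 (by linarith)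
  rw [← h2r] at b1
  rw [← h3r] at b2
  have r23p : (n2 : ℝ) ^ 120 ≤ (n3 : ℝ) ^ 120 := by gcongr
  have hth : 6000 * th ^ k < Real.exp (-(n3 : ℝ) ^ 120) := by
    have t1 := th_exp k
    have t2 := nat_le_exp 6000 9 (by norm_num)
    push_cast at t2
    have tp := th_pos
    calc 6000 * th ^ k ≤ Real.exp 9 * Real.exp (-((k : ℝ) / 4)) := by gcongr
      _ = Real.exp (9 + -((k : ℝ) / 4)) := by rw [Real.exp_add]
      _ < _ := by apply Real.exp_lt_exp.2; linarith
  have he1' : Real.exp (-(n3 : ℝ) ^ 120) ≤ 1 := by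
    rw [Real.exp_le_one_iff]; linarith
  have hth2 : 6000 * th ^ k < Real.exp (-(n2 : ℝ) ^ 120) :=
    hth.trans_le (Real.exp_le_exp.2 (by linarith))
  have tp := th_pos
  have tk : 0 < th ^ k := by positivity
  obtain ⟨j, s, hj, hs1, s1, s2, hF⟩ := sol_big h (by linarith) hk1
  have hs := abs_le.1 hs1
  have hδ : th ^ (2 * d) ≤ th ^ k := th_anti (by omega)
  have hj1 : th ^ (2 * j) ≤ 1 := pow_le_one₀ tp.le th_lt.le
  have hj0 : 0 < th ^ (2 * j) := by positivity
  have hε1 : th ^ (2 * e) ≤ 1 := pow_le_one₀ tp.le th_lt.le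
  have hε0 : 0 < th ^ (2 * e) := by positivity
  have hδ0 : 0 < th ^ (2 * d) := by positivity
  have hδε : th ^ (2 * d) * th ^ (2 * e) ≤ th ^ (2 * d) := by nlinarith
  have hδε' : th ^ (2 * d) * th ^ (2 * e) ≤ th ^ (2 * e) := by nlinarith [hδ0, pow_le_one₀ (n := 2 * d) tp.le th_lt.le]
  have hδε0 : 0 < th ^ (2 * d) * th ^ (2 * e) := by positivity
  have e12 : Real.exp n1 ≤ Real.exp n2 := Real.exp_le_exp.2 r12
  have e23 : Real.exp n2 ≤ Real.exp n3 := Real.exp_le_exp.2 r23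
  -- first
  have app1 := BkR n1 h10 (hN _ h1N) 0 j s 0 0 (by intro ρ _; simp)
    (by have := Real.add_one_le_exp (n1 : ℝ); linarith) (by simp) k hk1 hk hF
  have jb : (j : ℝ) ≤ 2 * (n1 : ℝ) ^ 120 + 10 := by
    apply exp_bd (C := 8.2 * 1.6 ^ 2) _ (by norm_num)
    refine app1.trans ?_
    rw [sub_zero, abs_of_nonneg (by positivity), mul_right_comm]
    gcongr
  -- second
  have app2 := BkR n2 (by omega) (hN _ (by omega)) 1 j s 1 1 (by intro ρ _; simp)
    (by
      have t1 := seven_pow j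
      have t2 := nat_le_exp 72 5 (by norm_num)
      have t3 : (1 : ℝ) ≤ 7 ^ j := one_le_pow₀ (by norm_num)
      push_cast at t2
      calc (70 : ℝ) * 7 ^ j * 1 + 2 ≤ 72 * 7 ^ j := by linarith
        _ ≤ Real.exp 5 * Real.exp (2 * j) := by gcongr
        _ = Real.exp (5 + 2 * j) := by rw [Real.exp_add]
        _ ≤ _ := by apply Real.exp_le_exp.2; linarith) (by simp) k hk1 (by linarith) hF
  have eb : (e : ℝ) ≤ 2 * (n2 : ℝ) ^ 120 + 10 := by
    apply exp_bd (C := 100) _ (by norm_num)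
    have t1 : |s ^ 2 - 1| ≤ (th ^ (2 * e) + 102 * th ^ k) * 3 := by
      have : s ^ 2 - 1 = (s - 1) * (s + 1) := by ring
      rw [this, abs_mul]
      apply mul_le_mul _ _ (abs_nonneg _) (by positivity)
      · rw [abs_le]; constructor <;> linarith
      · rw [abs_le]; constructor <;> linarith
    have t2 : 8.2 * th ^ (2 * j) * |s ^ 2 - 1| ≤ 8.2 * 1 * ((th ^ (2 * e) + 102 * th ^ k) * 3) := by gcongr
    linarith
  -- third
  have app3 := BkR n3 (by omega) (hN _ (by omega)) ((1 + Vp ^ e) ^ 2) j s ((1 + th ^ (2 * e)) ^ 2) ((1 + 7 ^ e) ^ 2)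
    (by
      intro ρ hρ
      have t1 := norm_Vp hρ
      simp only [map_pow, map_add, map_one]
      rw [norm_pow]
      gcongr
      refine (norm_add_le _ _).trans ?_
      rw [norm_one, norm_pow]
      gcongr)
    (by
      have t1 := seven_pow j
      have t1' := seven_pow (2 * e)
      have t2 := nat_le_exp 282 6 (by norm_num)
      have t3 : (1 : ℝ) ≤ 7 ^ j := one_le_pow₀ (by norm_num)
      have t4 : (1 : ℝ) ≤ 7 ^ e := one_le_pow₀ (by norm_num)
      have t5 : (1 : ℝ) ≤ 7 ^ (2 * e) := one_le_pow₀ (by norm_num)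
      have t6 : (1 + (7 : ℝ) ^ e) ^ 2 ≤ 4 * 7 ^ (2 * e) := by
        have : (7 : ℝ) ^ (2 * e) = (7 ^ e) ^ 2 := by ring
        rw [this]; nlinarith
      have t7 : (1 : ℝ) ≤ 7 ^ j * 7 ^ (2 * e) := one_le_mul_of_one_le_of_one_le t3 t5
      push_cast at t2 t1'
      calc (70 : ℝ) * 7 ^ j * (1 + 7 ^ e) ^ 2 + 2 ≤ 70 * 7 ^ j * (4 * 7 ^ (2 * e)) + 2 := by gcongr
        _ ≤ 282 * (7 ^ j * 7 ^ (2 * e)) := by linarith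
        _ ≤ Real.exp 6 * (Real.exp (2 * j) * Real.exp (2 * (2 * e))) := by gcongr
        _ = Real.exp (6 + (2 * j + 2 * (2 * e))) := by rw [Real.exp_add, Real.exp_add]
        _ ≤ _ := by apply Real.exp_le_exp.2; linarith)
    (by
      simp only [map_pow, map_add, map_one, aeval_Vp_al]
      push_cast
      rw [pow_mul]) k hk1 (by linarith) hF
  have t1 : |s ^ 2 - (1 + th ^ (2 * e)) ^ 2| ≤ (103 * th ^ k) * 4 := by
    have : s ^ 2 - (1 + th ^ (2 * e)) ^ 2 = (s - (1 + th ^ (2 * e))) * (s + (1 + th ^ (2 * e))) := by ring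
    rw [this, abs_mul]
    apply mul_le_mul _ _ (abs_nonneg _) (by positivity)
    · rw [abs_le]; constructor <;> linarith
    · rw [abs_le]; constructor <;> linarith
  have t2 : 8.2 * th ^ (2 * j) * |s ^ 2 - (1 + th ^ (2 * e)) ^ 2| ≤ 8.2 * 1 * ((103 * th ^ k) * 4) := by gcongr
  linarith

theorem ev_log (M N : ℕ) : ∃ K0 : ℕ, ∀ k : ℕ, K0 ≤ k → 4 * (((⌈Real.log k⌉₊ + N : ℕ) : ℝ) ^ M + 9) < k := by
  have h1 := (Real.isLittleO_pow_log_id_atTop (n := M + 1)).comp_tendsto tendsto_natCast_atTop_atTop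
  have h2 := h1.def (c := 1 / 4) (by norm_num)
  have h3 : Filter.Tendsto (fun k : ℕ => Real.log k) Filter.atTop Filter.atTop :=
    Real.tendsto_log_atTop.comp tendsto_natCast_atTop_atTop
  have h4 := h3.eventually_ge_atTop ((2 : ℝ) ^ M + 10 + N)
  obtain ⟨K0, hK⟩ := Filter.eventually_atTop.1 (h2.and h4)
  refine ⟨K0, fun k hk => ?_⟩
  obtain ⟨ha, hb⟩ := hK k hk
  simp only [Function.comp_apply, id] at ha
  set l := Real.log k with hl
  have hM : (1 : ℝ) ≤ 2 ^ M := one_le_pow₀ (by norm_num)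
  have hN0 : (0 : ℝ) ≤ N := by positivity
  have l1 : 1 ≤ l := by linarith
  rw [Real.norm_of_nonneg (by positivity), Real.norm_of_nonneg (by positivity)] at ha
  have hc : ((⌈l⌉₊ + N : ℕ) : ℝ) ≤ 2 * l := by
    push_cast
    have := Nat.ceil_lt_add_one (show 0 ≤ l by linarith)
    linarith
  have hp : ((⌈l⌉₊ + N : ℕ) : ℝ) ^ M ≤ 2 ^ M * l ^ M := by
    rw [← mul_pow]; gcongr
  have hl : 1 ≤ l ^ M := one_le_pow₀ l1
  have : l ^ (M + 1) = l * l ^ M := by ring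
  rw [this] at ha
  nlinarith

theorem k_bdd : ∃ K0 : ℕ, ∀ k d e u v w : ℕ, Sol k d e u v w → k < K0 := by
  obtain ⟨N0, hN⟩ : ∃ N0 : ℕ, ∀ n : ℕ, N0 ≤ n → (n : ℝ) ^ 200 ≤ Real.exp n := by
    have h1 := (Real.isLittleO_pow_exp_atTop (n := 200)).comp_tendsto tendsto_natCast_atTop_atTop
    have h2 := h1.def (c := 1) (by norm_num)
    obtain ⟨N0, h⟩ := Filter.eventually_atTop.1 h2
    refine ⟨N0, fun n hn => ?_⟩
    have := h n hn
    simp only [Function.comp_apply] at this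
    rwa [Real.norm_of_nonneg (by positivity), Real.norm_of_nonneg (by positivity), one_mul] at this
  obtain ⟨M, hM⟩ : ∃ M : ℕ, M = 121 * 121 * 120 := ⟨_, rfl⟩
  obtain ⟨K0, hK⟩ := ev_log M (N0 + 10000)
  refine ⟨K0, fun k d e u v w h => ?_⟩
  by_contra! hk
  have h1 := hK k hk
  have hk1 : 1 ≤ k := h.2.2.2.1
  obtain ⟨n1, hn1⟩ : ∃ n1 : ℕ, n1 = ⌈Real.log k⌉₊ + (N0 + 10000) := ⟨_, rfl⟩
  obtain ⟨n2, hn2⟩ : ∃ n2 : ℕ, n2 = n1 ^ 121 := ⟨_, rfl⟩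
  obtain ⟨n3, hn3⟩ : ∃ n3 : ℕ, n3 = n2 ^ 121 := ⟨_, rfl⟩
  rw [← hn1] at h1
  refine klarge h N0 hN n1 n2 n3 (by omega) (by omega) hn2 hn3 ?_ ?_
  · have hk0 : (0 : ℝ) < k := by exact_mod_cast hk1
    rw [← Real.log_le_iff_le_exp hk0, hn1]
    push_cast
    have := Nat.le_ceil (Real.log k)
    have : (0 : ℝ) ≤ N0 := by positivity
    linarith
  · have e : (n3 : ℝ) ^ 120 = (n1 : ℝ) ^ M := by
      rw [hn3, hn2, hM, Nat.cast_pow, Nat.cast_pow, pow_mul, pow_mul]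
    rw [e]
    exact h1

open Polynomial in
theorem nonint1 (k : ℕ) (m : ℤ) : ap * al ^ k ≠ m := by
  intro h
  have h1 : qE al * al ^ k = 44 * m := by
    rw [← h, ap]; ring
  have h1c : qE (al : ℂ) * al ^ k = 44 * m := by
    rw [← qE_cast]; exact_mod_cast h1
  have h2 := conj_be (Ep * X ^ k - 44 * (m : ℤ[X])) (by
    simp only [map_sub, map_mul, map_pow, aeval_Ep, aeval_X, map_ofNat, map_intCast, map_natCast]
    linear_combination h1c)
  simp only [map_sub, map_mul, map_pow, aeval_Ep, aeval_X, map_ofNat, map_intCast, map_natCast] at h2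
  have h2' : qE be * be ^ k = 44 * m := by linear_combination h2
  have h3 : qE ga * ga ^ k = 44 * m := by
    have e : qE ga * ga ^ k = (starRingEnd ℂ) (qE be * be ^ k) := by
      rw [ga_conj]; unfold qE; simp only [map_sub, map_add, map_mul, map_pow, map_ofNat]
    rw [e, h2']; simp only [map_mul, map_ofNat, map_intCast]
  have hp : (al : ℂ) ^ k * be ^ k * ga ^ k = 1 := by rw [← mul_pow, ← mul_pow, prod1, one_pow]
  have h4 : (44 * (m : ℂ)) ^ 3 = 44 ^ 2 := by
    calc (44 * (m : ℂ)) ^ 3 = (44 * m) * (44 * m) * (44 * m) := by ring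
      _ = (qE (al : ℂ) * al ^ k) * (qE be * be ^ k) * (qE ga * ga ^ k) := by rw [h1c, h2', h3]
      _ = (qE (al : ℂ) * qE be * qE ga) * ((al : ℂ) ^ k * be ^ k * ga ^ k) := by ring
      _ = _ := by rw [qE_prod, hp, mul_one]
  have h5 : (44 * m) ^ 3 = 44 ^ 2 := by exact_mod_cast h4
  have h6 : 44 * m ^ 3 = 1 := by nlinarith
  omega

open Polynomial in
theorem nonint2 (u d : ℕ) (hu : 1 ≤ u) (hd : 1 ≤ d) (m : ℤ) : (u : ℝ) * al ^ d ≠ m := by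
  intro h
  have h1c : (u : ℂ) * al ^ d = m := by exact_mod_cast h
  have h2 := conj_be ((u : ℤ[X]) * X ^ d - (m : ℤ[X])) (by
    simp only [map_sub, map_mul, map_pow, aeval_X, map_ofNat, map_intCast, map_natCast]
    linear_combination h1c)
  simp only [map_sub, map_mul, map_pow, aeval_X, map_ofNat, map_intCast, map_natCast] at h2
  have h2' : (u : ℂ) * be ^ d = m := by linear_combination h2
  have h3 : (u : ℝ) * th ^ d = |(m : ℝ)| := by
    have := congrArg norm h2'
    rwa [norm_mul, norm_pow, Complex.norm_natCast, Complex.norm_intCast] at this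
  have u0 : (0 : ℝ) < u := by exact_mod_cast hu
  have h4 : th ^ d < 1 := pow_lt_one₀ th_pos.le th_lt (by omega)
  have h5 : 1 < al ^ d := one_lt_pow₀ (by linarith [al_gt]) (by omega)
  have h6 := le_abs_self (m : ℝ)
  rw [← h, h] at h6
  rw [← h3, ← h] at h6
  nlinarith

theorem bern (d : ℕ) : (d : ℝ) * 0.8 ≤ al ^ d := by
  have := one_add_mul_le_pow (a := al - 1) (by linarith [al_gt]) d
  rw [add_sub_cancel] at this
  have := al_gt
  have : (0 : ℝ) ≤ d := by positivity
  nlinarith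

theorem d_bdd (k : ℕ) : ∃ D0 : ℕ, ∀ d e u v w : ℕ, Sol k d e u v w → d ≤ D0 := by
  set p := ap * al ^ k with hp
  have hc : 0 < |p - round p| := abs_pos.2 (sub_ne_zero.2 (nonint1 k _))
  set c := |p - round p| with hcd
  refine ⟨⌈130 / c⌉₊, fun d e u v w h => ?_⟩
  have hs := abs_le.1 (sol_s h)
  have h1 : c ≤ |p - (u : ℝ) ^ 2| := by
    have := round_le p ((u : ℤ) ^ 2)
    push_cast at this
    exact this
  have tp := th_pos
  have e1 : th ^ (k + d) ≤ 1 := pow_le_one₀ tp.le th_lt.le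
  have e2 : th ^ (2 * e) ≤ 1 := pow_le_one₀ tp.le th_lt.le
  have e3 : th ^ (2 * d) ≤ 1 := pow_le_one₀ tp.le th_lt.le
  have e4 : 0 < th ^ (2 * e) := by positivity
  have e5 : 0 < th ^ (2 * d) := by positivity
  have e6 : th ^ (2 * d) * th ^ (2 * e) ≤ th ^ (2 * e) := by nlinarith
  have e7 : 0 < th ^ (2 * d) * th ^ (2 * e) := by positivity
  have h2 : |p - (u : ℝ) ^ 2| * al ^ d ≤ 104 := by
    have ha := pow_pos al_pos d
    rw [← abs_of_pos ha, ← abs_mul, abs_le]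
    constructor <;> linarith
  have h3 := bern d
  have h4 : (d : ℝ) ≤ 130 / c := by
    rw [le_div_iff₀ hc]
    have : c * (d * 0.8) ≤ 104 := by
      calc _ ≤ |p - (u : ℝ) ^ 2| * al ^ d := by gcongr
        _ ≤ _ := h2
    linarith
  exact_mod_cast h4.trans (Nat.le_ceil _)

theorem e_bdd (k d u : ℕ) : ∃ B : ℕ, ∀ e v w : ℕ, Sol k d e u v w → e ≤ B := by
  by_cases hud : 1 ≤ u ∧ 1 ≤ d
  swap
  · exact ⟨0, fun e v w h => absurd ⟨h.1, h.2.2.2.2.1⟩ hud⟩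
  set p := (u : ℝ) * al ^ d with hp
  have hc : 0 < |p - round p| := abs_pos.2 (sub_ne_zero.2 (nonint2 u d hud.1 hud.2 _))
  set c := |p - round p| with hcd
  refine ⟨⌈40 * (T (k + d) : ℝ) / c⌉₊, fun e v w h => ?_⟩
  obtain ⟨hu, huv, hvw, hk, hd, he, hx, hy, hz⟩ := h
  have hyr : (u : ℝ) * w = ap * al ^ (k + d + e) + Fr (k + d + e) - 1 := by
    rw [← T_eq, ← hy]; push_cast; ring
  have hzr : (v : ℝ) * w = ap * al ^ (k + 2 * d + e) + Fr (k + 2 * d + e) - 1 := by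
    rw [← T_eq, ← hz]; push_cast; ring
  have hE : (u : ℝ) * (v * w) = v * (u * w) := by ring
  rw [hyr, hzr] at hE
  have hz1 : al ^ (k + 2 * d + e) = al ^ (k + d + e) * al ^ d := by ring
  rw [hz1] at hE
  have hE2 : ap * al ^ (k + d + e) * (p - v) = v * (Fr (k + d + e) - 1) - u * (Fr (k + 2 * d + e) - 1) := by
    rw [hp]; linear_combination hE
  have f1 := abs_le.1 ((Fr_le (k + d + e)).trans (pow_le_one₀ th_pos.le th_lt.le))
  have f2 := abs_le.1 ((Fr_le (k + 2 * d + e)).trans (pow_le_one₀ th_pos.le th_lt.le))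
  have u0 : (0 : ℝ) ≤ u := by positivity
  have uv : (u : ℝ) ≤ v := by exact_mod_cast huv.le
  have vT : (v : ℝ) ≤ T (k + d) := by
    rw [← hx]; push_cast
    have : (1 : ℝ) ≤ u := by exact_mod_cast hu
    nlinarith
  have h1 : c ≤ |p - v| := by
    have := round_le p (v : ℤ)
    push_cast at this
    exact this
  have ha : 0 < ap := by linarith [ap_bd.1]
  have hy0 := pow_pos al_pos (k + d + e)
  have h2 : ap * al ^ (k + d + e) * |p - v| ≤ 4 * T (k + d) := by
    have : ap * al ^ (k + d + e) * |p - v| = |ap * al ^ (k + d + e) * (p - v)| := by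
      rw [abs_mul, abs_of_pos (a := ap * al ^ (k + d + e)) (by positivity)]
    rw [this, hE2, abs_le]
    constructor <;> nlinarith
  have h3 : (e : ℝ) * 0.8 ≤ al ^ (k + d + e) :=
    (bern e).trans (pow_le_pow_right₀ (by linarith [al_gt]) (by omega))
  have h4 : (e : ℝ) ≤ 40 * (T (k + d) : ℝ) / c := by
    rw [le_div_iff₀ hc]
    have : 0.18 * (e * 0.8) * c ≤ 4 * T (k + d) := by
      calc _ ≤ ap * al ^ (k + d + e) * |p - v| := by
            gcongr
            exact ap_bd.1.le
        _ ≤ _ := h2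
    have : (0 : ℝ) ≤ T (k + d) := by positivity
    linarith
  exact_mod_cast h4.trans (Nat.le_ceil _)

theorem comb (P : ℕ → ℕ → Prop) (h : ∀ i, ∃ B, ∀ b, P i b → b ≤ B) (n : ℕ) :
    ∃ B, ∀ i ≤ n, ∀ b, P i b → b ≤ B := by
  choose B hB using h
  refine ⟨∑ i ∈ Finset.range (n + 1), B i, fun i hi b hb => (hB i b hb).trans ?_⟩
  exact Finset.single_le_sum (f := B) (fun _ _ => Nat.zero_le _) (Finset.mem_range.2 (by omega))

theorem T_mono : Monotone T := by
  apply monotone_nat_of_le_succ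
  intro n
  match n with
  | 0 => simp [T]
  | 1 => simp [T]
  | m + 2 => simp only [T]; omega

theorem z_bdd : ∃ N : ℕ, ∀ k d e u v w, Sol k d e u v w → k + 2 * d + e ≤ N := by
  obtain ⟨K0, hK⟩ := k_bdd
  obtain ⟨D0, hD⟩ := comb (fun k d => ∃ e u v w, Sol k d e u v w)
    (fun k => (d_bdd k).imp fun D h d ⟨e, u, v, w, hs⟩ => h d e u v w hs) K0
  have h1 : ∀ k d, ∃ B, ∀ e, (∃ u v w, Sol k d e u v w) → e ≤ B := by
    intro k d
    obtain ⟨B, hB⟩ := comb (fun u e => ∃ v w, Sol k d e u v w)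
      (fun u => (e_bdd k d u).imp fun B h e ⟨v, w, hs⟩ => h e v w hs) (T (k + d))
    refine ⟨B, fun e ⟨u, v, w, hs⟩ => hB u ?_ e ⟨v, w, hs⟩⟩
    obtain ⟨hu, huv, hvw, hk, hd, he, hx, hy, hz⟩ := hs
    nlinarith
  have h2 : ∀ k, ∃ B, ∀ e, (∃ d u v w, d ≤ D0 ∧ Sol k d e u v w) → e ≤ B := by
    intro k
    obtain ⟨B, hB⟩ := comb (fun d e => ∃ u v w, Sol k d e u v w) (h1 k) D0
    exact ⟨B, fun e ⟨d, u, v, w, hd, hs⟩ => hB d hd e ⟨u, v, w, hs⟩⟩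
  obtain ⟨B, hB⟩ := comb (fun k e => ∃ d u v w, d ≤ D0 ∧ Sol k d e u v w) h2 K0
  refine ⟨K0 + 2 * D0 + B, fun k d e u v w hs => ?_⟩
  have a1 := (hK k d e u v w hs).le
  have a2 := hD k a1 d ⟨e, u, v, w, hs⟩
  have a3 := hB k a1 e ⟨d, u, v, w, a2, hs⟩
  omega

theorem exists_sol (u v w x y z : ℕ) (hu : 1 ≤ u) (huv : u < v) (hvw : v < w) (hx : 1 + u * v = T x)
    (hy : 1 + u * w = T y) (hz : 1 + v * w = T z) : ∃ k d e, Sol k d e u v w ∧ z = k + 2 * d + e := by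
  have hxy : x < y := by
    by_contra! h
    have := T_mono h
    rw [← hx, ← hy] at this
    nlinarith
  have hyz : y < z := by
    by_contra! h
    have := T_mono h
    rw [← hz, ← hy] at this
    nlinarith
  have hx5 : 5 ≤ x := by apply T_small; rw [← hx]; nlinarith
  have hzxy : z < x + y := by
    by_contra! h
    have hxr : (u : ℝ) * v = ap * al ^ x + Fr x - 1 := by
      rw [← T_eq, ← hx]; push_cast; ring
    have hyr : (u : ℝ) * w = ap * al ^ y + Fr y - 1 := by
      rw [← T_eq, ← hy]; push_cast; ring
    have hzr : (v : ℝ) * w = ap * al ^ z + Fr z - 1 := by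
      rw [← T_eq, ← hz]; push_cast; ring
    have f1 := abs_le.1 ((Fr_le x).trans (pow_le_one₀ th_pos.le th_lt.le))
    have f2 := abs_le.1 ((Fr_le y).trans (pow_le_one₀ th_pos.le th_lt.le))
    have f3 := abs_le.1 ((Fr_le z).trans (pow_le_one₀ th_pos.le th_lt.le))
    have ha := ap_bd
    have e3 : al ^ 6 ≤ al ^ z := pow_le_pow_right₀ (by linarith [al_gt]) (by omega)
    have e4 : (1.8 : ℝ) ^ 6 ≤ al ^ 6 := by gcongr; linarith [al_gt]
    norm_num at e4
    have e5 : al ^ (x + y) ≤ al ^ z := pow_le_pow_right₀ (by linarith [al_gt]) h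
    have g1 : (u : ℝ) * v ≤ ap * al ^ x := by linarith
    have g2 : (u : ℝ) * w ≤ ap * al ^ y := by linarith
    have g3 : (v : ℝ) * w ≤ (u * v) * (u * w) := by
      have : (1 : ℝ) ≤ u := by exact_mod_cast hu
      have : (1 : ℝ) ≤ u * u := by nlinarith
      have : (0 : ℝ) ≤ v * w := by positivity
      nlinarith
    have hap : 0 < ap := by linarith
    have g4 : ((u : ℝ) * v) * (u * w) ≤ (ap * al ^ x) * (ap * al ^ y) := by
      have := al_pos
      gcongr
    have g5 : (ap * al ^ x) * (ap * al ^ y) = ap * (ap * al ^ (x + y)) := by ring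
    have g6 : ap * (ap * al ^ (x + y)) ≤ 0.19 * (ap * al ^ z) := by
      have := al_pos
      gcongr
      exact ha.2.le
    nlinarith
  refine ⟨x + y - z, z - y, y - x, ⟨hu, huv, hvw, by omega, by omega, by omega, ?_, ?_, ?_⟩, by omega⟩
  · rw [hx]; congr 1; omega
  · rw [hy]; congr 1; omega
  · rw [hz]; congr 1; omega

theorem final_fin : {t : ℤ × ℤ × ℤ | 1 ≤ t.1 ∧ t.1 < t.2.1 ∧ t.2.1 < t.2.2 ∧
      ∃ x y z : ℕ, 0 < x ∧ 0 < y ∧ 0 < z ∧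
        1 + t.1 * t.2.1 = (T x : ℤ) ∧ 1 + t.1 * t.2.2 = (T y : ℤ) ∧
        1 + t.2.1 * t.2.2 = (T z : ℤ)}.Finite := by
  obtain ⟨N, hN⟩ := z_bdd
  apply ((Set.finite_Icc (0 : ℤ) (T N)).prod ((Set.finite_Icc (0 : ℤ) (T N)).prod (Set.finite_Icc (0 : ℤ) (T N)))).subset
  rintro ⟨u, v, w⟩ ⟨hu, huv, hvw, x, y, z, -, -, -, hx, hy, hz⟩
  simp only at hu huv hvw hx hy hz
  lift u to ℕ using by omega
  lift v to ℕ using by omega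
  lift w to ℕ using by omega
  norm_cast at hu huv hvw hx hy hz
  obtain ⟨k, d, e, hs, hzz⟩ := exists_sol u v w x y z hu huv hvw hx hy hz
  have h1 := T_mono (hN _ _ _ _ _ _ hs)
  rw [← hzz, ← hz] at h1
  have h2 : w ≤ T N := by nlinarith
  simp only [Set.mem_prod, Set.mem_Icc]
  refine ⟨⟨by positivity, ?_⟩, ⟨by positivity, ?_⟩, ⟨by positivity, ?_⟩⟩ <;> norm_cast <;> omega

/-- If there are infinitely many Tribonacci Diophantine triples `1 ≤ u < v < w`,
then there is a rational line in `ℝ³` containing infinitely many of the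
corresponding exponent triples `(x, y, z)` at integer parameter values. -/
theorem solutions_on_a_line
    (h : {t : ℤ × ℤ × ℤ | 1 ≤ t.1 ∧ t.1 < t.2.1 ∧ t.2.1 < t.2.2 ∧
      ∃ x y z : ℕ, 0 < x ∧ 0 < y ∧ 0 < z ∧
        1 + t.1 * t.2.1 = (T x : ℤ) ∧ 1 + t.1 * t.2.2 = (T y : ℤ) ∧
        1 + t.2.1 * t.2.2 = (T z : ℤ)}.Infinite) :
    ∃ r₁ r₂ r₃ s₁ s₂ s₃ : ℚ,
      {p : ℕ × ℕ × ℕ | (0 < p.1 ∧ 0 < p.2.1 ∧ 0 < p.2.2 ∧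
        ∃ u v w : ℤ, 1 ≤ u ∧ u < v ∧ v < w ∧
          1 + u * v = (T p.1 : ℤ) ∧ 1 + u * w = (T p.2.1 : ℤ) ∧
          1 + v * w = (T p.2.2 : ℤ)) ∧
        ∃ n : ℤ, (p.1 : ℚ) = r₁ * n + s₁ ∧ (p.2.1 : ℚ) = r₂ * n + s₂ ∧
          (p.2.2 : ℚ) = r₃ * n + s₃}.Infinite := by
  exact absurd final_fin h
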